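/- arXiv:2506.22317 — 6 statements merged into one kernel-verified Lean document; each statement's English description precedes it below -/
import Mathlib

section
/- Fix an integer m ≥ 2. Then the ratio |NIMIS(G_{m×n})| / |MIS(G_{m×n})| tends to 1/4 as n tends to infinity. -/
open SimpleGraph Finset

/-- A maximal independent set of a simple graph, as a `Finset` of vertices. -/
def IsMaxIndep {V : Type*} (G : SimpleGraph V) (s : Finset V) : Prop :=
  (∀ ⦃u⦄, u ∈ s → ∀ ⦃v⦄, v ∈ s → ¬ G.Adj u v) ∧
  ∀ t : Finset V, (∀ ⦃u⦄, u ∈ t → ∀ ⦃v⦄, v ∈ t → ¬ G.Adj u v) → s ⊆ t → s = t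

/-- The finite set of all maximal independent sets of `G`. -/
noncomputable def misFinset {V : Type*} [Fintype V] (G : SimpleGraph V) : Finset (Finset V) := by
  classical exact Finset.univ.filter (IsMaxIndep G)

/-- The number of orbits of maximal independent sets of `G` under the action of the
automorphism group of `G`. -/
noncomputable def nimisCard {V : Type*} [Fintype V] [DecidableEq V] (G : SimpleGraph V) : ℕ :=
  Nat.card (Quot (fun M N : {s : Finset V // IsMaxIndep G s} =>
    ∃ e : G ≃g G, (M : Finset V).image e = (N : Finset V)))

/-- The grid graph `G_{m×n}`, the box product of two path graphs. -/
def gridGraph (m n : ℕ) : SimpleGraph (Fin m × Fin n) := pathGraph m □ pathGraph n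

section General

variable {V : Type*} {G : SimpleGraph V}

theorem isMaxIndep_iff_dominating [DecidableEq V] {s : Finset V} :
    IsMaxIndep G s ↔
      (∀ ⦃u⦄, u ∈ s → ∀ ⦃v⦄, v ∈ s → ¬ G.Adj u v) ∧ ∀ v, v ∉ s → ∃ u ∈ s, G.Adj u v := by
  constructor
  · rintro ⟨h, hmax⟩
    refine ⟨h, fun v hv => ?_⟩
    by_contra! hcon
    have := hmax (insert v s) ?_ (subset_insert v s)
    · exact hv (this ▸ mem_insert_self v s)
    · intro a ha b hb hab
      rw [mem_insert] at ha hb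
      rcases ha with rfl | ha <;> rcases hb with rfl | hb
      · exact G.irrefl hab
      · exact hcon b hb hab.symm
      · exact hcon a ha hab
      · exact h ha hb hab
  · rintro ⟨h, hdom⟩
    refine ⟨h, fun t ht hst => hst.antisymm fun v hv => ?_⟩
    by_contra hvs
    obtain ⟨u, hu, huv⟩ := hdom v hvs
    exact ht (hst hu) hv huv

theorem exists_isMaxIndep_superset [Fintype V] (s : Finset V)
    (hs : ∀ ⦃u⦄, u ∈ s → ∀ ⦃v⦄, v ∈ s → ¬ G.Adj u v) :
    ∃ t, s ⊆ t ∧ IsMaxIndep G t := by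
  obtain ⟨t, hst, ht⟩ :=
    (Set.toFinite {t : Finset V | ∀ ⦃u⦄, u ∈ t → ∀ ⦃v⦄, v ∈ t → ¬ G.Adj u v}).exists_le_maximal hs
  exact ⟨t, hst, ht.1, fun r hr htr => htr.antisymm (ht.2 hr htr)⟩

/-- A maximal independent set can be modified within distance two of an independent set `P`
so as to contain `P`. -/
theorem IsMaxIndep.exists_superset_eq_away [Fintype V] [DecidableEq V] {M : Finset V}
    (hM : IsMaxIndep G M) (P : Finset V) (hP : ∀ ⦃u⦄, u ∈ P → ∀ ⦃v⦄, v ∈ P → ¬ G.Adj u v) :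
    ∃ N, IsMaxIndep G N ∧ P ⊆ N ∧ ∀ v, (v ∈ N ↔ v ∈ M) ∨ v ∈ P ∨
      ∃ p ∈ P, ∃ a, G.Adj p a ∧ (v = a ∨ G.Adj a v) := by
  classical
  rw [isMaxIndep_iff_dominating] at hM
  obtain ⟨N, hSN, hN⟩ := exists_isMaxIndep_superset (G := G)
    (M.filter (fun v => ∀ p ∈ P, ¬ G.Adj p v) ∪ P) (by
      intro u hu v hv huv
      simp only [mem_union, mem_filter] at hu hv
      rcases hu with hu | hu <;> rcases hv with hv | hv
      · exact hM.1 hu.1 hv.1 huv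
      · exact hu.2 v hv huv.symm
      · exact hv.2 u hu huv
      · exact hP hu hv huv)
  refine ⟨N, hN, subset_union_right.trans hSN, fun v => ?_⟩
  by_cases hvP : v ∈ P
  · exact .inr (.inl hvP)
  by_cases hvM : v ∈ M <;> by_cases hvN : v ∈ N
  · simp [hvM, hvN]
  · right; right
    by_contra! hcon
    refine hvN (hSN (mem_union_left _ (mem_filter.2 ⟨hvM, fun p hp hpv => ?_⟩)))
    exact (hcon p hp v hpv).1 rfl
  · right; right
    obtain ⟨u, hu, huv⟩ := hM.2 v hvM
    by_contra! hcon
    refine hN.1 (hSN (mem_union_left _ (mem_filter.2 ⟨hu, fun p hp hpu => ?_⟩))) hvN huv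
    exact (hcon p hp u hpu).2 huv
  · simp [hvM, hvN]

theorem IsMaxIndep.image [DecidableEq V] {s : Finset V} (hs : IsMaxIndep G s) (g : G ≃g G) :
    IsMaxIndep G (s.image g) := by
  rw [isMaxIndep_iff_dominating] at hs ⊢
  refine ⟨?_, fun v hv => ?_⟩
  · simp only [mem_image]
    rintro _ ⟨u, hu, rfl⟩ _ ⟨v, hv, rfl⟩ huv
    exact hs.1 hu hv (g.map_adj_iff.1 huv)
  · obtain ⟨u, hu, huv⟩ := hs.2 (g.symm v) fun h => hv (mem_image.2 ⟨_, h, g.apply_symm_apply v⟩)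
    refine ⟨g u, mem_image_of_mem _ hu, ?_⟩
    rwa [← g.map_adj_iff, g.apply_symm_apply] at huv

@[simp]
theorem mem_misFinset [Fintype V] {s : Finset V} : s ∈ misFinset G ↔ IsMaxIndep G s := by
  simp [misFinset]

theorem misFinset_nonempty [Fintype V] (G : SimpleGraph V) : (misFinset G).Nonempty := by
  obtain ⟨t, -, ht⟩ := exists_isMaxIndep_superset (G := G) ∅ (by simp)
  exact ⟨t, mem_misFinset.2 ht⟩

/-- The maximal independent sets invariant under the automorphism `g`. -/
noncomputable def fixedMis [Fintype V] [DecidableEq V] (g : G ≃g G) : Finset (Finset V) :=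
  (misFinset G).filter fun M => M.image g = M

/-- The action of the automorphism group on maximal independent sets. -/
noncomputable instance misMulAction [DecidableEq V] :
    MulAction (G ≃g G) {s : Finset V // IsMaxIndep G s} where
  smul g M := ⟨(M : Finset V).image g, M.2.image g⟩
  one_smul M := Subtype.ext (by
    change (M : Finset V).image (fun v => v) = M
    exact image_id)
  mul_smul g h M := Subtype.ext (by
    change (M : Finset V).image (fun v => g (h v)) = ((M : Finset V).image h).image g
    rw [image_image]
    rfl)

theorem sum_card_fixedMis [Fintype V] [DecidableEq V] [Fintype (G ≃g G)] :
    ∑ g : G ≃g G, (fixedMis g).card = nimisCard G * Fintype.card (G ≃g G) := by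
  classical
  have h := MulAction.sum_card_fixedBy_eq_card_orbits_mul_card_group (G ≃g G)
    {s : Finset V // IsMaxIndep G s}
  have hfix (g : G ≃g G) : (fixedMis g).card =
      Fintype.card (MulAction.fixedBy {s : Finset V // IsMaxIndep G s} g) := by
    rw [← Fintype.card_coe]
    refine Fintype.card_congr
      { toFun := fun M => ⟨⟨M.1, mem_misFinset.1 (mem_filter.1 M.2).1⟩,
          Subtype.ext (mem_filter.1 M.2).2⟩
        invFun := fun M => ⟨M.1.1, mem_filter.2 ⟨mem_misFinset.2 M.1.2, congrArg Subtype.val M.2⟩⟩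
        left_inv := fun _ => rfl
        right_inv := fun _ => rfl }
  simp_rw [hfix]
  rw [h, nimisCard, ← Nat.card_eq_fintype_card]
  congr 1
  refine Nat.card_congr (Quot.congrRight fun M N => ?_)
  rw [MulAction.orbitRel_apply, MulAction.mem_orbit_symm]
  exact exists_congr fun g => Subtype.ext_iff

/-- If there are many disjoint places where invariance under `g` can be destroyed locally, then
few maximal independent sets are invariant under `g`. -/
theorem card_fixedMis_mul_card_le [Fintype V] [DecidableEq V] {ι : Type*} [DecidableEq ι]
    (g : G ≃g G) (idx : V → ι) (w : ℕ) (hw : ∀ i, #{v | idx v = i} ≤ w) (I : Finset ι)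
    (x y : ι → V) (hxy : ∀ i ∈ I, ¬ G.Adj (x i) (y i))
    (hgxy : ∀ i ∈ I, G.Adj (g (x i)) (y i))
    (hball : ∀ i ∈ I, ∀ p, p = x i ∨ p = y i → idx p = i ∧
      ∀ a, G.Adj p a → idx a = i ∧ ∀ b, G.Adj a b → idx b = i) :
    (fixedMis g).card * I.card ≤ (misFinset G).card * (2 * 2 ^ w) := by
  classical
  have key (M : Finset V) (i : ι) (hi : i ∈ I) (hM : IsMaxIndep G M) :
      ∃ N, IsMaxIndep G N ∧ (∃ v ∈ N, g v ∉ N) ∧ ∀ v, idx v ≠ i → (v ∈ N ↔ v ∈ M) := by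
    obtain ⟨N, hN, hPN, hNM⟩ := hM.exists_superset_eq_away {x i, y i} (by
      simp only [mem_insert, mem_singleton]
      rintro _ (rfl | rfl) _ (rfl | rfl)
      · exact G.irrefl
      · exact hxy i hi
      · exact fun h => hxy i hi h.symm
      · exact G.irrefl)
    refine ⟨N, hN, ⟨x i, hPN (by simp), fun h => hN.1 h (hPN (by simp)) (hgxy i hi)⟩,
      fun v hv => ?_⟩
    rcases hNM v with h | h | ⟨p, hp, a, hpa, rfl | hav⟩
    · exact h
    · exact absurd (hball i hi v (by simpa using h)).1 hv
    · exact absurd ((hball i hi p (by simpa using hp)).2 v hpa).1 hv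
    · exact absurd (((hball i hi p (by simpa using hp)).2 a hpa).2 v hav) hv
  let r : Finset V → Finset V → Prop := fun M N =>
    (∃ v ∈ N, g v ∉ N) ∧ ∃ i ∈ I, ∀ v, idx v ≠ i → (v ∈ N ↔ v ∈ M)
  have hfixed {M : Finset V} (hM : M ∈ fixedMis g) (v : V) : g v ∈ M ↔ v ∈ M := by
    have h := (mem_filter.1 hM).2
    constructor
    · intro hv
      rw [← h] at hv
      obtain ⟨u, hu, huv⟩ := mem_image.1 hv
      rwa [← g.injective huv]
    · intro hv
      rw [← h]
      exact mem_image_of_mem _ hv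
  refine card_mul_le_card_mul r (fun M hM => ?_) (fun N hN => ?_)
  · have hM' := mem_misFinset.1 (mem_filter.1 hM).1
    choose! F hF using fun i (hi : i ∈ I) => key M i hi hM'
    refine card_le_card_of_injOn F (fun i hi => ?_) (fun i hi j hj hij => ?_)
    · obtain ⟨h1, h2, h3⟩ := hF i hi
      exact mem_coe.2 ((mem_bipartiteAbove r).2 ⟨mem_misFinset.2 h1, h2, i, hi, h3⟩)
    · by_contra hne'
      obtain ⟨v, hv, hgv⟩ := (hF i hi).2.1
      have hsame (u : V) : u ∈ F i ↔ u ∈ M := by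
        by_cases hu : idx u = i
        · rw [hij]
          exact (hF j hj).2.2 u (hu ▸ hne')
        · exact (hF i hi).2.2 u hu
      rw [hsame] at hv hgv
      exact hgv ((hfixed hM v).2 hv)
  · by_cases hsym : ∃ v ∈ N, g v ∉ N
    swap
    · rw [card_eq_zero.2]
      · exact Nat.zero_le _
      · refine eq_empty_of_forall_notMem fun M hM => hsym ((mem_bipartiteBelow r).1 hM).2.1
    obtain ⟨v, hv, hgv⟩ := hsym
    have hsub : bipartiteBelow r (fixedMis g) N ⊆ ({idx v, idx (g v)} : Finset ι).biUnion
        fun i => ({u | idx u = i} : Finset V).powerset.image fun S => symmDiff N S := by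
      intro M hM
      obtain ⟨hMf, -, i, hi, hag⟩ := (mem_bipartiteBelow r).1 hM
      refine mem_biUnion.2 ⟨i, ?_, mem_image.2 ⟨symmDiff N M, ?_, symmDiff_symmDiff_cancel_left N M⟩⟩
      · by_contra hcon
        simp only [mem_insert, mem_singleton, not_or] at hcon
        exact hgv ((hag _ (Ne.symm hcon.2)).2
          ((hfixed hMf v).2 ((hag _ (Ne.symm hcon.1)).1 hv)))
      · refine mem_powerset.2 fun u hu => mem_filter.2 ⟨mem_univ _, ?_⟩
        by_contra hui
        have := hag u hui
        rw [mem_symmDiff] at hu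
        tauto
    calc _ ≤ _ := card_le_card hsub
      _ ≤ #{idx v, idx (g v)} * 2 ^ w := card_biUnion_le_card_mul _ _ _ fun i _ =>
          card_image_le.trans (by
            rw [card_powerset]
            exact Nat.pow_le_pow_right two_pos (hw i))
      _ ≤ 2 * 2 ^ w := Nat.mul_le_mul_right _ card_le_two

end General

section Grid

variable {m n : ℕ}

/-- The `ℓ¹` distance on the vertices of a grid. -/
def gridDist (u v : Fin m × Fin n) : ℕ :=
  ((u.1 : ℤ) - v.1).natAbs + ((u.2 : ℤ) - v.2).natAbs

theorem gridGraph_adj_iff {u v : Fin m × Fin n} : (gridGraph m n).Adj u v ↔ gridDist u v = 1 := by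
  simp only [gridGraph, boxProd_adj, pathGraph_adj, gridDist, Fin.ext_iff]
  omega

theorem gridDist_triangle (u v w : Fin m × Fin n) :
    gridDist u w ≤ gridDist u v + gridDist v w := by
  simp only [gridDist]
  omega

theorem gridDist_eq_zero {u v : Fin m × Fin n} : gridDist u v = 0 ↔ u = v := by
  simp only [gridDist, Prod.ext_iff, Fin.ext_iff]
  omega

theorem exists_gridDist_eq_one {u v : Fin m × Fin n} (h : u ≠ v) :
    ∃ w, gridDist u w = 1 ∧ gridDist w v + 1 = gridDist u v := by
  obtain ⟨⟨i, hi⟩, ⟨j, hj⟩⟩ := u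
  obtain ⟨⟨k, hk⟩, ⟨l, hl⟩⟩ := v
  simp only [ne_eq, Prod.mk.injEq, Fin.mk.injEq] at h
  rcases lt_trichotomy i k with h1 | h1 | h1
  · exact ⟨(⟨i + 1, by omega⟩, ⟨j, hj⟩), by simp only [gridDist]; omega⟩
  · rcases lt_trichotomy j l with h2 | h2 | h2
    · exact ⟨(⟨i, hi⟩, ⟨j + 1, by omega⟩), by simp only [gridDist]; omega⟩
    · omega
    · exact ⟨(⟨i, hi⟩, ⟨j - 1, by omega⟩), by simp only [gridDist]; omega⟩
  · exact ⟨(⟨i - 1, by omega⟩, ⟨j, hj⟩), by simp only [gridDist]; omega⟩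

theorem gridDist_map_le (g : gridGraph m n ≃g gridGraph m n) (u v : Fin m × Fin n) :
    gridDist (g u) (g v) ≤ gridDist u v := by
  induction hd : gridDist u v generalizing u with
  | zero => rw [gridDist_eq_zero.1 hd, gridDist_eq_zero.2 rfl]
  | succ d ih =>
    have hne : u ≠ v := fun h => by
      have := gridDist_eq_zero.2 h
      omega
    obtain ⟨w, huw, hwv⟩ := exists_gridDist_eq_one hne
    have h1 := ih w (by omega)
    have h2 : gridDist (g u) (g w) = 1 :=
      gridGraph_adj_iff.1 (g.map_adj_iff.2 (gridGraph_adj_iff.2 huw))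
    have h3 := gridDist_triangle (g u) (g w) (g v)
    omega

theorem gridDist_map (g : gridGraph m n ≃g gridGraph m n) (u v : Fin m × Fin n) :
    gridDist (g u) (g v) = gridDist u v := by
  refine (gridDist_map_le g u v).antisymm ?_
  simpa using gridDist_map_le g.symm (g u) (g v)

/-- The symmetry of the grid reversing the first coordinate if `a` and the second one if `b`. -/
def gridSymm (m n : ℕ) (a b : Bool) : gridGraph m n ≃g gridGraph m n where
  toEquiv := Equiv.prodCongr (bif a then Fin.revPerm else Equiv.refl _)
    (bif b then Fin.revPerm else Equiv.refl _)
  map_rel_iff' := by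
    intro u v
    rw [gridGraph_adj_iff, gridGraph_adj_iff]
    cases a <;> cases b <;> simp [gridDist, Fin.val_rev] <;> omega

theorem gridSymm_apply_fst (a b : Bool) (u : Fin m × Fin n) :
    ((gridSymm m n a b u).1 : ℕ) = bif a then m - 1 - u.1 else u.1 := by
  cases a <;> simp [gridSymm, Fin.val_rev]
  omega

theorem gridSymm_apply_snd (a b : Bool) (u : Fin m × Fin n) :
    ((gridSymm m n a b u).2 : ℕ) = bif b then n - 1 - u.2 else u.2 := by
  cases b <;> simp [gridSymm, Fin.val_rev]
  omega

theorem gridIso_eq_one (hm : 2 ≤ m) (hmn : m < n) (g : gridGraph m n ≃g gridGraph m n)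
    (h : g (⟨0, by omega⟩, ⟨0, by omega⟩) = (⟨0, by omega⟩, ⟨0, by omega⟩)) : g = 1 := by
  have hcorner : g (⟨m - 1, by omega⟩, ⟨0, by omega⟩) = (⟨m - 1, by omega⟩, ⟨0, by omega⟩) := by
    have h1 := gridDist_map g (⟨m - 1, by omega⟩, ⟨0, by omega⟩) (⟨0, by omega⟩, ⟨0, by omega⟩)
    have h2 := gridDist_map g (⟨m - 1, by omega⟩, ⟨0, by omega⟩) (⟨0, by omega⟩, ⟨n - 1, by omega⟩)
    have h3 := gridDist_map g (⟨0, by omega⟩, ⟨n - 1, by omega⟩) (⟨0, by omega⟩, ⟨0, by omega⟩)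
    rw [h] at h1 h3
    generalize g (⟨m - 1, by omega⟩, ⟨0, by omega⟩) = p at *
    generalize g (⟨0, by omega⟩, ⟨n - 1, by omega⟩) = q at *
    obtain ⟨⟨i, hi⟩, ⟨j, hj⟩⟩ := p
    obtain ⟨⟨k, hk⟩, ⟨l, hl⟩⟩ := q
    simp only [gridDist, Prod.mk.injEq, Fin.mk.injEq] at *
    omega
  ext1 u
  have h1 := gridDist_map g u (⟨0, by omega⟩, ⟨0, by omega⟩)
  have h2 := gridDist_map g u (⟨m - 1, by omega⟩, ⟨0, by omega⟩)
  rw [h] at h1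
  rw [hcorner] at h2
  change g u = u
  simp only [gridDist, Prod.ext_iff, Fin.ext_iff] at *
  omega

theorem gridSymm_bijective (hm : 2 ≤ m) (hmn : m < n) :
    Function.Bijective fun p : Bool × Bool => gridSymm m n p.1 p.2 := by
  constructor
  · rintro ⟨a, b⟩ ⟨c, d⟩ h
    have h := DFunLike.congr_fun h (⟨0, by omega⟩, ⟨0, by omega⟩)
    have h1 := congrArg (fun u => (u.1 : ℕ)) h
    have h2 := congrArg (fun u => (u.2 : ℕ)) h
    simp only [gridSymm_apply_fst, gridSymm_apply_snd] at h1 h2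
    cases a <;> cases b <;> cases c <;> cases d <;> simp at h1 h2 ⊢ <;> omega
  · intro g
    have h := gridDist_map g (⟨0, by omega⟩, ⟨0, by omega⟩) (⟨m - 1, by omega⟩, ⟨n - 1, by omega⟩)
    obtain ⟨a, b, hab⟩ : ∃ a b, gridSymm m n a b (⟨0, by omega⟩, ⟨0, by omega⟩) =
        g (⟨0, by omega⟩, ⟨0, by omega⟩) := by
      simp only [Prod.ext_iff, Fin.ext_iff, gridSymm_apply_fst, gridSymm_apply_snd]
      generalize g (⟨0, by omega⟩, ⟨0, by omega⟩) = p at *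
      generalize g (⟨m - 1, by omega⟩, ⟨n - 1, by omega⟩) = q at *
      refine ⟨p.1.1 ≠ 0, p.2.1 ≠ 0, ?_⟩
      obtain ⟨⟨i, hi⟩, ⟨j, hj⟩⟩ := p
      obtain ⟨⟨k, hk⟩, ⟨l, hl⟩⟩ := q
      simp only [gridDist] at h
      by_cases hi0 : i = 0 <;> by_cases hj0 : j = 0 <;> simp [hi0, hj0] <;> omega
    refine ⟨(a, b), ?_⟩
    have := gridIso_eq_one hm hmn ((gridSymm m n a b)⁻¹ * g) (by
      change (gridSymm m n a b).symm (g _) = _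
      rw [← hab, RelIso.symm_apply_apply])
    exact (inv_mul_eq_one.1 this)

theorem four_mul_nimisCard_gridGraph (hm : 2 ≤ m) (hmn : m < n) :
    4 * nimisCard (gridGraph m n) = (misFinset (gridGraph m n)).card +
      (fixedMis (gridSymm m n false true)).card + (fixedMis (gridSymm m n true false)).card +
      (fixedMis (gridSymm m n true true)).card := by
  classical
  have hb := gridSymm_bijective hm hmn
  let _ : Fintype (gridGraph m n ≃g gridGraph m n) := Fintype.ofBijective _ hb
  have h := sum_card_fixedMis (G := gridGraph m n)
  rw [← Fintype.card_of_bijective hb, ← hb.sum_comp (fun g => (fixedMis g).card)] at h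
  have hid : fixedMis (gridSymm m n false false) = misFinset (gridGraph m n) := by
    refine filter_true_of_mem fun M _ => ?_
    exact image_id
  simp only [Fintype.sum_prod_type, Fintype.sum_bool, hid, Fintype.card_prod,
    Fintype.card_bool] at h
  omega

theorem card_filter_min_rev_div_le (i : ℕ) :
    #{v : Fin m × Fin n | min (v.2 : ℕ) (n - 1 - v.2) / 8 = i} ≤ m * 16 := by
  have hsub : ({v : Fin m × Fin n | min (v.2 : ℕ) (n - 1 - v.2) / 8 = i} : Finset _) ⊆
      univ ×ˢ ({c : Fin n | min (c : ℕ) (n - 1 - c) / 8 = i} : Finset _) := by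
    intro v
    simp
  have hcol : #{c : Fin n | min (c : ℕ) (n - 1 - c) / 8 = i} ≤ 16 := by
    calc _ ≤ #(Ico (8 * i) (8 * i + 8) ∪ (Ico (8 * i) (8 * i + 8)).image (fun c => n - 1 - c)) := by
          refine card_le_card_of_injOn Fin.val (fun c hc => ?_) Fin.val_injective.injOn
          have hc : min (c : ℕ) (n - 1 - c) / 8 = i := by simpa using hc
          simp only [coe_union, coe_image, Set.mem_union, mem_coe, mem_Ico, Set.mem_image]
          by_cases h : (c : ℕ) ≤ n - 1 - c
          · left
            omega
          · exact .inr ⟨n - 1 - c, by omega, by omega⟩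
      _ ≤ 8 + 8 := (card_union_le _ _).trans (by
          have := card_image_le (s := Ico (8 * i) (8 * i + 8)) (f := fun c => n - 1 - c)
          simp only [Nat.card_Ico] at this ⊢
          omega)
  calc _ ≤ _ := card_le_card hsub
    _ ≤ m * 16 := by
      rw [card_product, card_univ, Fintype.card_fin]
      exact Nat.mul_le_mul_left m hcol

theorem card_fixedMis_gridSymm_mul_le (hm : 2 ≤ m) (a b : Bool) (hab : a = true ∨ b = true) :
    (fixedMis (gridSymm m n a b)).card * (n / 16) ≤
      (misFinset (gridGraph m n)).card * (2 * 2 ^ (m * 16)) := by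
  rcases Nat.eq_zero_or_pos n with rfl | hn
  · simp
  have h := card_fixedMis_mul_card_le (gridSymm m n a b)
    (fun v => min (v.2 : ℕ) (n - 1 - v.2) / 8) (m * 16) card_filter_min_rev_div_le (range (n / 16))
    (fun i => (⟨0, by omega⟩, ⟨min (8 * i + 3) (n - 1), by omega⟩))
    (fun i => (⟨bif a then m - 1 else 0, by cases a <;> simp <;> omega⟩,
      ⟨bif b then n - 1 - (8 * i + 4) else min (8 * i + 4) (n - 1),
        by cases b <;> simp <;> omega⟩))
    ?_ ?_ ?_
  · simpa using h
  · intro i hi h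
    rw [mem_range] at hi
    simp only [gridGraph_adj_iff, gridDist] at h
    cases a <;> cases b <;> simp at h hab <;> omega
  · intro i hi
    rw [mem_range] at hi
    simp only [gridGraph_adj_iff, gridDist, gridSymm_apply_fst, gridSymm_apply_snd]
    cases a <;> cases b <;> simp at hab ⊢ <;> omega
  · intro i hi p hp
    rw [mem_range] at hi
    have hp' : (p.2 : ℕ) = 8 * i + 3 ∨ (p.2 : ℕ) = 8 * i + 4 ∨
        (p.2 : ℕ) = n - 1 - (8 * i + 4) := by
      rcases hp with rfl | rfl
      · left
        simp only
        omega
      · cases b <;> simp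
        omega
    simp only [gridGraph_adj_iff, gridDist]
    refine ⟨by omega, fun q hq => ⟨by omega, fun r hr => by omega⟩⟩

theorem tendsto_card_fixedMis_gridSymm_div (hm : 2 ≤ m) (a b : Bool) (hab : a = true ∨ b = true) :
    Filter.Tendsto
      (fun n : ℕ => ((fixedMis (gridSymm m n a b)).card : ℝ) /
        ((misFinset (gridGraph m n)).card : ℝ)) Filter.atTop (nhds 0) := by
  have hk : Filter.Tendsto (fun n : ℕ => ((n / 16 : ℕ) : ℝ)) Filter.atTop Filter.atTop :=
    tendsto_natCast_atTop_atTop.comp (Nat.tendsto_div_const_atTop (by norm_num))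
  refine squeeze_zero' (.of_forall fun n => by positivity) ?_
    (hk.const_div_atTop (2 * 2 ^ (m * 16) : ℝ))
  filter_upwards [Filter.eventually_ge_atTop 16] with n hn
  have hN : (0 : ℝ) < (misFinset (gridGraph m n)).card :=
    Nat.cast_pos.2 (misFinset_nonempty _).card_pos
  have hn' : (0 : ℝ) < (n / 16 : ℕ) := Nat.cast_pos.2 (by omega)
  rw [div_le_div_iff₀ hN hn']
  have := card_fixedMis_gridSymm_mul_le (n := n) hm a b hab
  rw [mul_comm (2 * 2 ^ (m * 16) : ℝ)]
  exact_mod_cast this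

end Grid

theorem nimis_over_mis_tendsto_quarter (m : ℕ) (hm : 2 ≤ m) :
    Filter.Tendsto
      (fun n : ℕ => (nimisCard (gridGraph m n) : ℝ) / ((misFinset (gridGraph m n)).card : ℝ))
      Filter.atTop (nhds (1 / 4)) := by
  have h1 := tendsto_card_fixedMis_gridSymm_div hm false true (.inr rfl)
  have h2 := tendsto_card_fixedMis_gridSymm_div hm true false (.inl rfl)
  have h3 := tendsto_card_fixedMis_gridSymm_div hm true true (.inl rfl)
  have h := ((((tendsto_const_nhds (x := (1 : ℝ))).add h1).add h2).add h3).div_const 4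
  simp only [add_zero] at h
  refine h.congr' ?_
  filter_upwards [Filter.eventually_gt_atTop m] with n hn
  have hN : ((misFinset (gridGraph m n)).card : ℝ) ≠ 0 :=
    Nat.cast_ne_zero.2 (misFinset_nonempty _).card_pos.ne'
  have h4 : (4 : ℝ) * nimisCard (gridGraph m n) = (misFinset (gridGraph m n)).card +
      (fixedMis (gridSymm m n false true)).card + (fixedMis (gridSymm m n true false)).card +
      (fixedMis (gridSymm m n true true)).card := by
    exact_mod_cast four_mul_nimisCard_gridGraph hm hn
  field_simp
  linarith
end

section
/- For every integer n ≥ 2, the number of orbits of maximal independent sets of the thin grid cylinder T_{3×n} under its automorphism group equals 2^{n-3} + 2^{⌈(n-4)/2⌉} (an equality of rational numbers, where the exponents may be negative for small n). -/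
open SimpleGraph Finset

/-- The thin grid cylinder `T_{m×n}`, the box product of a cycle graph and a path graph. -/
def thinCylinder (m n : ℕ) : SimpleGraph (Fin m × Fin n) := cycleGraph m □ pathGraph n

/-! ### Counting the orbits of an involution -/

/-- The orbit relation of an involution. -/
def involutionSetoid {α : Type*} (t : α → α) (ht : Function.Involutive t) : Setoid α where
  r x y := y = x ∨ y = t x
  iseqv :=
    { refl := fun _ => Or.inl rfl
      symm := by
        rintro x y (rfl | rfl)
        · exact Or.inl rfl
        · exact Or.inr (ht x).symm
      trans := by
        rintro x y z (rfl | rfl) (rfl | rfl)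
        · exact Or.inl rfl
        · exact Or.inr rfl
        · exact Or.inr rfl
        · exact Or.inl (ht x) }

theorem two_mul_card_quotient_involutionSetoid {α : Type*} [Fintype α] [DecidableEq α]
    (t : α → α) (ht : Function.Involutive t) :
    2 * Nat.card (Quotient (involutionSetoid t ht)) =
      Fintype.card α + #{x : α | t x = x} := by
  classical
  set π : α → Quotient (involutionSetoid t ht) := Quotient.mk _ with hπ
  have hmk (x y : α) : π y = π x ↔ x = y ∨ x = t y := Quotient.eq
  rw [← Finset.card_univ (α := α), Nat.card_eq_fintype_card, ← Finset.card_univ,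
    Finset.card_eq_sum_card_fiberwise (f := π) (t := univ) (by simp),
    Finset.card_eq_sum_card_fiberwise (s := {x : α | t x = x}) (f := π) (t := univ) (by simp),
    ← Finset.sum_add_distrib, mul_comm, ← smul_eq_mul, ← Finset.sum_const]
  refine Finset.sum_congr rfl fun q _ => ?_
  obtain ⟨x, rfl⟩ := Quotient.exists_rep q
  have hfib : ({y ∈ (univ : Finset α) | π y = π x}) = {x, t x} := by
    ext y
    simp only [Finset.mem_filter, Finset.mem_univ, true_and, Finset.mem_insert,
      Finset.mem_singleton, hmk]
    constructor
    · rintro (rfl | rfl)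
      · exact Or.inl rfl
      · exact Or.inr (ht y).symm
    · rintro (rfl | rfl)
      · exact Or.inl rfl
      · exact Or.inr (ht x).symm
  have hfix : ({y ∈ ({y | t y = y} : Finset α) | π y = π x}) = {y ∈ ({x, t x} : Finset α) | t y = y} := by
    rw [← hfib, Finset.filter_filter, Finset.filter_filter]
    simp only [and_comm]
  change 2 = #{y ∈ (univ : Finset α) | π y = π x} + #{y ∈ ({y | t y = y} : Finset α) | π y = π x}
  rw [hfix, hfib]
  by_cases hx : t x = x
  · simp [hx, Finset.filter_singleton]
  · have hx' : x ≠ t x := fun h => hx h.symm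
    simp [Finset.filter_insert, Finset.filter_singleton, ht x, hx, hx']

/-- Reversal of a finite word. -/
def reverseWord {k : ℕ} (p : Fin k → Bool) : Fin k → Bool := p ∘ Fin.rev

theorem reverseWord_involutive {k : ℕ} : Function.Involutive (reverseWord (k := k)) := by
  intro p
  ext i
  simp [reverseWord]

theorem card_palindromes (k : ℕ) :
    #{p : Fin k → Bool | reverseWord p = p} = 2 ^ ((k + 1) / 2) := by
  have hcard : Fintype.card (Fin ((k + 1) / 2) → Bool) = 2 ^ ((k + 1) / 2) := by simp
  rw [← hcard, ← Finset.card_univ]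
  refine Finset.card_bij' (fun p _ i => p ⟨i, by omega⟩)
    (fun g _ i => g ⟨min i (k - 1 - i), by omega⟩) (by simp) ?_ ?_ ?_
  · intro g _
    simp only [Finset.mem_filter, Finset.mem_univ, true_and]
    refine funext fun i => congrArg g (Fin.ext ?_)
    simp only [Fin.val_rev]
    omega
  · intro p hp
    simp only [Finset.mem_filter, Finset.mem_univ, true_and] at hp
    refine funext fun i => ?_
    rcases le_total i.val (k - 1 - i) with h | h
    · exact congrArg p (Fin.ext (min_eq_left h))
    · rw [← congrFun hp i]
      refine congrArg p (Fin.ext ?_)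
      simp only [Fin.val_rev]
      omega
  · intro g _
    refine funext fun i => congrArg g (Fin.ext ?_)
    dsimp only
    omega

/-! ### The structure of the thin cylinder of circumference three -/

theorem thinCylinder_three_adj {n : ℕ} (u v : Fin 3 × Fin n) :
    (thinCylinder 3 n).Adj u v ↔
      (u.1 ≠ v.1 ∧ u.2 = v.2) ∨
        (u.1 = v.1 ∧ (u.2.val + 1 = v.2.val ∨ v.2.val + 1 = u.2.val)) := by
  have h3 : ∀ a b : Fin 3, (cycleGraph 3).Adj a b ↔ a ≠ b := by
    simp only [cycleGraph_adj]
    decide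
  simp only [thinCylinder, boxProd_adj, h3, pathGraph_adj]
  tauto

/-- Maximality of an independent set means that it dominates the graph. -/
theorem isMaxIndep_iff {V : Type*} [DecidableEq V] (G : SimpleGraph V) (s : Finset V) :
    IsMaxIndep G s ↔ (∀ ⦃u⦄, u ∈ s → ∀ ⦃v⦄, v ∈ s → ¬ G.Adj u v) ∧
      ∀ v ∉ s, ∃ u ∈ s, G.Adj u v := by
  refine and_congr_right fun hs => ⟨fun h v hv => ?_, fun h t ht hst => ?_⟩
  · by_contra! hc
    refine hv ?_
    rw [h (insert v s) ?_ (Finset.subset_insert v s)]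
    · exact Finset.mem_insert_self v s
    · intro a ha b hb hab
      rw [Finset.mem_insert] at ha hb
      rcases ha with rfl | ha <;> rcases hb with rfl | hb
      · exact G.loopless.irrefl _ hab
      · exact hc _ hb hab.symm
      · exact hc _ ha hab
      · exact hs ha hb hab
  · refine Finset.Subset.antisymm hst fun v hv => ?_
    by_contra hvs
    obtain ⟨u, hu, huv⟩ := h v hvs
    exact ht (hst hu) hv huv

/-- The set of vertices `(f j, j)` of the cylinder selected by a function `f` on the columns. -/
def rowSelection {n : ℕ} (f : Fin n → Fin 3) : Finset (Fin 3 × Fin n) :=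
  {v | v.1 = f v.2}

theorem mem_rowSelection {n : ℕ} (f : Fin n → Fin 3) (a : Fin 3) (j : Fin n) :
    (a, j) ∈ rowSelection f ↔ a = f j := by
  simp [rowSelection]

/-- A row selection is proper if consecutive columns select different rows. -/
def IsProperSelection {n : ℕ} (f : Fin n → Fin 3) : Prop :=
  ∀ i j : Fin n, i.val + 1 = j.val → f i ≠ f j

theorem isMaxIndep_rowSelection {n : ℕ} {f : Fin n → Fin 3} (hf : IsProperSelection f) :
    IsMaxIndep (thinCylinder 3 n) (rowSelection f) := by
  rw [isMaxIndep_iff]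
  constructor
  · rintro ⟨a, i⟩ ha ⟨b, j⟩ hb hab
    rw [mem_rowSelection] at ha hb
    rw [thinCylinder_three_adj] at hab
    subst ha hb
    rcases hab with ⟨h, h'⟩ | ⟨h, h' | h'⟩
    · exact h (congrArg f h')
    · exact hf i j h' h
    · exact hf j i h' h.symm
  · rintro ⟨a, i⟩ ha
    rw [mem_rowSelection] at ha
    exact ⟨(f i, i), by simp [mem_rowSelection],
      (thinCylinder_three_adj _ _).2 (Or.inl ⟨Ne.symm ha, rfl⟩)⟩

theorem IsMaxIndep.exists_rowSelection {n : ℕ} {s : Finset (Fin 3 × Fin n)}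
    (hs : IsMaxIndep (thinCylinder 3 n) s) :
    ∃ f : Fin n → Fin 3, IsProperSelection f ∧ s = rowSelection f := by
  rw [isMaxIndep_iff] at hs
  obtain ⟨hind, hdom⟩ := hs
  have huniq {a b : Fin 3} {j : Fin n} (ha : (a, j) ∈ s) (hb : (b, j) ∈ s) : a = b := by
    by_contra hab
    exact hind ha hb ((thinCylinder_three_adj _ _).2 (Or.inl ⟨hab, rfl⟩))
  have hex (j : Fin n) : ∃ a, (a, j) ∈ s := by
    by_contra! hj
    have hnbr (a : Fin 3) : ∃ i : Fin n, (a, i) ∈ s ∧ (i.val + 1 = j.val ∨ j.val + 1 = i.val) := by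
      obtain ⟨⟨b, i⟩, hb, hadj⟩ := hdom (a, j) (hj a)
      rw [thinCylinder_three_adj] at hadj
      rcases hadj with ⟨_, h⟩ | ⟨h, h'⟩
      · dsimp only at h
        subst h
        exact absurd hb (hj b)
      · dsimp only at h h'
        subst h
        exact ⟨i, hb, h'⟩
    choose c hc hcj using hnbr
    have hne (a b : Fin 3) (hab : a ≠ b) : (c a).val ≠ (c b).val := by
      intro h
      have hcb := hc b
      rw [← Fin.ext h] at hcb
      exact hab (huniq (hc a) hcb)
    have h01 := hne 0 1 (by decide)
    have h02 := hne 0 2 (by decide)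
    have h12 := hne 1 2 (by decide)
    have h0 := hcj 0
    have h1 := hcj 1
    have h2 := hcj 2
    omega
  choose f hf using hex
  refine ⟨f, fun i j hij h => ?_, ?_⟩
  · exact hind (hf i) (hf j) ((thinCylinder_three_adj _ _).2 (Or.inr ⟨h, Or.inl hij⟩))
  · ext ⟨a, j⟩
    rw [mem_rowSelection]
    exact ⟨fun h => huniq h (hf j), fun h => h ▸ hf j⟩

/-! ### Automorphisms of the cylinder -/

/-- An injective self-map of `Fin n` preserving adjacency in the path is the identity or the
reversal. -/
theorem eq_id_or_eq_rev_of_path {n : ℕ} (t : Fin n → Fin n) (ht : Function.Injective t)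
    (hadj : ∀ i j : Fin n, i.val + 1 = j.val →
      (t i).val + 1 = (t j).val ∨ (t j).val + 1 = (t i).val) :
    t = id ∨ t = Fin.rev := by
  rcases Nat.lt_or_ge n 2 with hn | hn
  · left
    ext i
    simp only [id]
    omega
  have hne (i j : Fin n) (h : i.val ≠ j.val) : (t i).val ≠ (t j).val :=
    fun h' => h (congrArg Fin.val (ht (Fin.ext h')))
  have hstep (i : ℕ) (hi : i + 2 < n) :
      (t ⟨i, by omega⟩).val + (t ⟨i + 2, hi⟩).val = 2 * (t ⟨i + 1, by omega⟩).val := by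
    have h1 := hadj ⟨i, by omega⟩ ⟨i + 1, by omega⟩ rfl
    have h2 := hadj ⟨i + 1, by omega⟩ ⟨i + 2, hi⟩ rfl
    have h3 := hne ⟨i, by omega⟩ ⟨i + 2, hi⟩ (by simp)
    omega
  have hlin (i : ℕ) : ∀ hi : i + 1 < n,
      ((t ⟨i, by omega⟩).val : ℤ) = (t ⟨0, by omega⟩).val +
        i * ((t ⟨1, by omega⟩).val - (t ⟨0, by omega⟩).val : ℤ) ∧
      ((t ⟨i + 1, hi⟩).val : ℤ) = (t ⟨0, by omega⟩).val +
        (i + 1) * ((t ⟨1, by omega⟩).val - (t ⟨0, by omega⟩).val : ℤ) := by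
    induction i with
    | zero => intro hi; simp
    | succ i ih =>
      intro hi
      obtain ⟨ha, hb⟩ := ih (by omega)
      have hs : ((t ⟨i, by omega⟩).val : ℤ) + (t ⟨i + 2, hi⟩).val =
        2 * (t ⟨i + 1, by omega⟩).val := by exact_mod_cast hstep i hi
      refine ⟨by rw [hb]; push_cast; ring, ?_⟩
      push_cast
      linarith
  have hall (i : Fin n) : ((t i).val : ℤ) = (t ⟨0, by omega⟩).val +
        i.val * ((t ⟨1, by omega⟩).val - (t ⟨0, by omega⟩).val : ℤ) := by
    rcases Nat.lt_or_ge (i.val + 1) n with hi | hi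
    · exact (hlin i hi).1
    · obtain ⟨m, hm⟩ : ∃ m, i.val = m + 1 := ⟨i.val - 1, by omega⟩
      have h := (hlin m (by omega)).2
      have hi' : i = ⟨m + 1, by omega⟩ := Fin.ext hm
      rw [hi']
      push_cast
      exact h
  have h01 := hadj ⟨0, by omega⟩ ⟨1, by omega⟩ rfl
  have hlast := hall ⟨n - 1, by omega⟩
  have hlt := (t ⟨n - 1, by omega⟩).isLt
  have hlt0 := (t ⟨0, by omega⟩).isLt
  rcases h01 with h | h
  · left
    have hd : ((t ⟨1, by omega⟩).val - (t ⟨0, by omega⟩).val : ℤ) = 1 := by omega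
    rw [hd] at hall hlast
    ext i
    have := hall i
    simp only [id] at *
    omega
  · right
    have hd : ((t ⟨1, by omega⟩).val - (t ⟨0, by omega⟩).val : ℤ) = -1 := by omega
    rw [hd] at hall hlast
    ext i
    have := hall i
    simp only [Fin.val_rev] at *
    omega

/-- Every automorphism of the cylinder is a product of an injection of the rows and either the
identity or the reversal of the columns. -/
theorem thinCylinder_three_iso_apply {n : ℕ} (e : thinCylinder 3 n ≃g thinCylinder 3 n) :
    ∃ (r : Fin 3 → Fin 3) (t : Fin n → Fin n), Function.Injective r ∧ (t = id ∨ t = Fin.rev) ∧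
      ∀ a j, e (a, j) = (r a, t j) := by
  have hadj (u v : Fin 3 × Fin n) :=
    (e.map_adj_iff (v := u) (w := v)).trans (thinCylinder_three_adj u v)
  simp only [thinCylinder_three_adj] at hadj
  have hcol (a b : Fin 3) (j : Fin n) : (e (a, j)).2 = (e (b, j)).2 := by
    by_cases hab : a = b
    · rw [hab]
    obtain ⟨c, hca, hcb⟩ : ∃ c : Fin 3, c ≠ a ∧ c ≠ b := by decide +revert
    have h1 := (hadj (a, j) (b, j)).2 (Or.inl ⟨hab, rfl⟩)
    have h2 := (hadj (c, j) (a, j)).2 (Or.inl ⟨hca, rfl⟩)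
    have h3 := (hadj (c, j) (b, j)).2 (Or.inl ⟨hcb, rfl⟩)
    simp only [Fin.ext_iff] at h1 h2 h3 ⊢
    omega
  have hcol_inj (i j : Fin n) (h : (e (0, i)).2 = (e (0, j)).2) : i = j := by
    by_contra hij
    have hne : e (0, i) ≠ e (1, j) := fun h' => by simpa using e.injective h'
    have hnadj := mt (hadj (0, i) (1, j)).1 (by simp [hij])
    have h2 : (e (0, i)).2 = (e (1, j)).2 := h.trans (hcol 0 1 j)
    refine hne (Prod.ext ?_ h2)
    by_contra h1
    exact hnadj (Or.inl ⟨h1, h2⟩)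
  have hstep (a : Fin 3) (i j : Fin n) (hij : i.val + 1 = j.val) :
      (e (a, i)).1 = (e (a, j)).1 ∧ ((e (a, i)).2.val + 1 = (e (a, j)).2.val ∨
        (e (a, j)).2.val + 1 = (e (a, i)).2.val) := by
    rcases (hadj (a, i) (a, j)).2 (Or.inr ⟨rfl, Or.inl hij⟩) with ⟨_, h⟩ | h
    · rw [hcol a 0, hcol a 0 j] at h
      have := congrArg Fin.val (hcol_inj i j h)
      omega
    · exact h
  rcases Nat.eq_zero_or_pos n with rfl | hn
  · exact ⟨id, id, Function.injective_id, Or.inl rfl, fun _ j => j.elim0⟩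
  have hrow (a : Fin 3) (i : ℕ) : ∀ hi : i < n, (e (a, ⟨i, hi⟩)).1 = (e (a, ⟨0, hn⟩)).1 := by
    induction i with
    | zero => intro _; rfl
    | succ i ih =>
      intro hi
      rw [← ih (by omega)]
      exact ((hstep a ⟨i, by omega⟩ ⟨i + 1, hi⟩ rfl).1).symm
  refine ⟨fun a => (e (a, ⟨0, hn⟩)).1, fun j => (e (0, j)).2, ?_, ?_, ?_⟩
  · intro a b h
    have := e.injective (Prod.ext h (hcol a b ⟨0, hn⟩))
    exact congrArg Prod.fst this
  · exact eq_id_or_eq_rev_of_path _ (fun i j h => hcol_inj i j h)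
      fun i j hij => (hstep 0 i j hij).2
  · exact fun a j => Prod.ext (hrow a j j.isLt) (hcol a 0 j)

/-- The automorphism of the cylinder induced by a permutation of the rows. -/
def rowIso (n : ℕ) (r : Equiv.Perm (Fin 3)) : thinCylinder 3 n ≃g thinCylinder 3 n where
  toEquiv := Equiv.prodCongr r (Equiv.refl _)
  map_rel_iff' := by
    rintro ⟨a, i⟩ ⟨b, j⟩
    simp [thinCylinder_three_adj]

/-- The automorphism of the cylinder that reverses the order of the columns. -/
def revIso (n : ℕ) : thinCylinder 3 n ≃g thinCylinder 3 n where
  toEquiv := Equiv.prodCongr (Equiv.refl _) Fin.revPerm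
  map_rel_iff' := by
    rintro ⟨a, i⟩ ⟨b, j⟩
    simp only [thinCylinder_three_adj, Equiv.prodCongr_apply, Prod.map_apply, Equiv.refl_apply,
      Fin.revPerm_apply, Fin.val_rev, Fin.ext_iff]
    omega

theorem image_rowIso_rowSelection {n : ℕ} (r : Equiv.Perm (Fin 3)) (f : Fin n → Fin 3) :
    (rowSelection f).image (rowIso n r) = rowSelection (r ∘ f) := by
  ext ⟨a, j⟩
  simp [rowIso, rowSelection, eq_comm]

theorem image_revIso_rowSelection {n : ℕ} (f : Fin n → Fin 3) :
    (rowSelection f).image (revIso n) = rowSelection (f ∘ Fin.rev) := by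
  ext ⟨a, j⟩
  simp only [revIso, Finset.mem_image, Prod.exists, mem_rowSelection, Function.comp_apply]
  constructor
  · rintro ⟨b, i, rfl, h⟩
    obtain ⟨rfl, rfl⟩ := Prod.mk.inj h
    simp
  · rintro rfl
    exact ⟨_, j.rev, rfl, Prod.ext rfl (Fin.rev_rev j)⟩

/-! ### The return word of a selection -/

/-- The word recording, for each `i`, whether columns `i` and `i + 2` meet the set in a
common row. -/
def returnWord {k : ℕ} (s : Finset (Fin 3 × Fin (k + 2))) (i : Fin k) : Bool :=
  decide (∃ a, (a, i.castAdd 2) ∈ s ∧ (a, i.addNat 2) ∈ s)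

theorem returnWord_rowSelection {k : ℕ} (f : Fin (k + 2) → Fin 3) (i : Fin k) :
    returnWord (rowSelection f) i = decide (f (i.castAdd 2) = f (i.addNat 2)) := by
  simp [returnWord, mem_rowSelection]

theorem returnWord_rowSelection_comp_rev {k : ℕ} (f : Fin (k + 2) → Fin 3) :
    returnWord (rowSelection (f ∘ Fin.rev)) = reverseWord (returnWord (rowSelection f)) := by
  ext i
  have h1 : (i.castAdd 2).rev = i.rev.addNat 2 := by
    ext; simp only [Fin.val_rev, Fin.val_castAdd, Fin.val_addNat]; omega
  have h2 : (i.addNat 2).rev = i.rev.castAdd 2 := by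
    ext; simp only [Fin.val_rev, Fin.val_castAdd, Fin.val_addNat]; omega
  simp [reverseWord, returnWord_rowSelection, h1, h2, eq_comm]

theorem returnWord_rowSelection_comp {k : ℕ} (f : Fin (k + 2) → Fin 3) {r : Fin 3 → Fin 3}
    (hr : Function.Injective r) :
    returnWord (rowSelection (r ∘ f)) = returnWord (rowSelection f) := by
  ext i
  simp [returnWord_rowSelection, hr.eq_iff]

theorem IsProperSelection.comp_rev {n : ℕ} {f : Fin n → Fin 3} (hf : IsProperSelection f) :
    IsProperSelection (f ∘ Fin.rev) := by
  intro i j hij h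
  exact hf j.rev i.rev (by simp only [Fin.val_rev]; omega) h.symm

theorem exists_isProperSelection_returnWord {k : ℕ} (p : Fin k → Bool) :
    ∃ f : Fin (k + 2) → Fin 3, IsProperSelection f ∧ returnWord (rowSelection f) = p := by
  let c : ℕ → Fin 3 × Fin 3 := Nat.rec (0, 1) fun i x =>
    (x.2, if h : i < k then (if p ⟨i, h⟩ then x.1 else -(x.1 + x.2)) else x.1)
  have hc (i : ℕ) : c (i + 1) = ((c i).2,
      if h : i < k then (if p ⟨i, h⟩ then (c i).1 else -((c i).1 + (c i).2)) else (c i).1) := rfl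
  have hthird : ∀ a b : Fin 3, a ≠ b → b ≠ -(a + b) ∧ a ≠ -(a + b) := by decide
  have hne (i : ℕ) : (c i).1 ≠ (c i).2 := by
    induction i with
    | zero => simp [c]
    | succ i ih =>
      rw [hc]
      dsimp only
      split_ifs
      · exact ih.symm
      · exact (hthird _ _ ih).1
      · exact ih.symm
  refine ⟨fun i => (c i).1, ?_, ?_⟩
  · intro i j hij
    dsimp only
    rw [← hij, hc]
    exact hne i
  · ext i
    rw [returnWord_rowSelection]
    simp only [Fin.val_castAdd, Fin.val_addNat, hc, i.isLt, dif_pos]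
    by_cases h : p i
    · simp [h]
    · simpa [h] using (hthird _ _ (hne i)).2

theorem exists_perm_comp_eq_of_returnWord_eq {k : ℕ} {f g : Fin (k + 2) → Fin 3}
    (hf : IsProperSelection f) (hg : IsProperSelection g)
    (h : returnWord (rowSelection f) = returnWord (rowSelection g)) :
    ∃ r : Equiv.Perm (Fin 3), g = r ∘ f := by
  have htrans : ∀ a b a' b' : Fin 3, a ≠ b → a' ≠ b' →
      ∃ r : Equiv.Perm (Fin 3), r a = a' ∧ r b = b' := by decide
  have hthird : ∀ a b c d : Fin 3, a ≠ b → c ≠ a → c ≠ b → d ≠ a → d ≠ b → c = d := by decide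
  obtain ⟨r, hr0, hr1⟩ := htrans (f 0) (f 1) (g 0) (g 1) (hf 0 1 rfl) (hg 0 1 rfl)
  have key (i : ℕ) : ∀ hi : i + 1 < k + 2, g ⟨i, by omega⟩ = r (f ⟨i, by omega⟩) ∧
      g ⟨i + 1, hi⟩ = r (f ⟨i + 1, hi⟩) := by
    induction i with
    | zero => exact fun _ => ⟨hr0.symm, hr1.symm⟩
    | succ i ih =>
      intro hi
      obtain ⟨h0, h1⟩ := ih (by omega)
      refine ⟨h1, ?_⟩
      have hw := congrFun h ⟨i, by omega⟩
      rw [returnWord_rowSelection, returnWord_rowSelection, decide_eq_decide] at hw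
      change (f ⟨i, by omega⟩ = f ⟨i + 2, hi⟩) ↔ (g ⟨i, by omega⟩ = g ⟨i + 2, hi⟩) at hw
      change g ⟨i + 2, hi⟩ = r (f ⟨i + 2, hi⟩)
      by_cases hc : f ⟨i, by omega⟩ = f ⟨i + 2, hi⟩
      · rw [← hc, ← hw.1 hc, h0]
      · have hf2 := hf ⟨i + 1, by omega⟩ ⟨i + 2, hi⟩ rfl
        refine hthird (g ⟨i, by omega⟩) (g ⟨i + 1, by omega⟩) _ _ (hg _ _ rfl)
          (fun h' => hc (hw.2 h'.symm)) (hg _ _ rfl).symm ?_ ?_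
        · rw [h0]
          exact fun h' => hc (r.injective h').symm
        · rw [h1]
          exact fun h' => hf2 (r.injective h').symm
  refine ⟨r, funext fun j => ?_⟩
  rcases Nat.eq_zero_or_pos j.val with hj | hj
  · have hj' : j = 0 := Fin.ext hj
    rw [hj']
    exact hr0.symm
  · obtain ⟨m, hm⟩ : ∃ m, j.val = m + 1 := ⟨j.val - 1, by omega⟩
    have hj' : j = ⟨m + 1, by omega⟩ := Fin.ext hm
    rw [hj']
    exact (key m (by omega)).2

/-- Two maximal independent sets are isomorphic exactly when their return words agree up to
reversal. -/
theorem exists_iso_image_eq_iff {k : ℕ} {f g : Fin (k + 2) → Fin 3}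
    (hf : IsProperSelection f) (hg : IsProperSelection g) :
    (∃ e : thinCylinder 3 (k + 2) ≃g thinCylinder 3 (k + 2),
      (rowSelection f).image e = rowSelection g) ↔
    (returnWord (rowSelection g) = returnWord (rowSelection f) ∨
      returnWord (rowSelection g) = reverseWord (returnWord (rowSelection f))) := by
  constructor
  · rintro ⟨e, he⟩
    obtain ⟨r, t, hr, ht, hrt⟩ := thinCylinder_three_iso_apply e
    have hgt (j : Fin (k + 2)) : r (f j) = g (t j) := by
      rw [← mem_rowSelection, ← he, ← hrt]
      exact Finset.mem_image_of_mem _ ((mem_rowSelection _ _ _).2 rfl)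
    rcases ht with rfl | rfl
    · left
      have : g = r ∘ f := funext fun j => (hgt j).symm
      rw [this, returnWord_rowSelection_comp f hr]
    · right
      have : g = r ∘ (f ∘ Fin.rev) := funext fun j => by simp [hgt]
      rw [this, returnWord_rowSelection_comp _ hr, returnWord_rowSelection_comp_rev]
  · rintro (h | h)
    · obtain ⟨r, rfl⟩ := exists_perm_comp_eq_of_returnWord_eq hf hg h.symm
      exact ⟨rowIso _ r, image_rowIso_rowSelection r f⟩
    · rw [← returnWord_rowSelection_comp_rev] at h
      obtain ⟨r, rfl⟩ := exists_perm_comp_eq_of_returnWord_eq hf.comp_rev hg h.symm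
      refine ⟨(revIso _).trans (rowIso _ r), ?_⟩
      rw [← image_rowIso_rowSelection, ← image_revIso_rowSelection, Finset.image_image]
      rfl

theorem Nat.card_quot_eq_card_quotient {α β : Type*} (r : α → α → Prop) (s : Setoid β)
    (F : α → β) (hF : Function.Surjective F) (h : ∀ a b, r a b ↔ s.r (F a) (F b)) :
    Nat.card (Quot r) = Nat.card (Quotient s) := by
  refine Nat.card_eq_of_bijective
    (Quot.lift (fun a => Quotient.mk s (F a)) fun a b hab => Quotient.sound ((h a b).1 hab)) ⟨?_, ?_⟩
  · rintro ⟨a⟩ ⟨b⟩ hab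
    exact Quot.sound ((h a b).2 (Quotient.exact hab))
  · rintro ⟨b⟩
    obtain ⟨a, rfl⟩ := hF b
    exact ⟨Quot.mk r a, rfl⟩

theorem two_mul_nimisCard_thinCylinder_three (k : ℕ) :
    2 * nimisCard (thinCylinder 3 (k + 2)) = 2 ^ k + 2 ^ ((k + 1) / 2) := by
  have hcard : Fintype.card (Fin k → Bool) = 2 ^ k := by simp
  rw [← card_palindromes, ← hcard,
    ← two_mul_card_quotient_involutionSetoid reverseWord reverseWord_involutive]
  congr 1
  refine Nat.card_quot_eq_card_quotient _ _ (fun M => returnWord M.1) ?_ ?_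
  · intro p
    obtain ⟨f, hf, rfl⟩ := exists_isProperSelection_returnWord p
    exact ⟨⟨_, isMaxIndep_rowSelection hf⟩, rfl⟩
  · rintro ⟨M, hM⟩ ⟨N, hN⟩
    obtain ⟨f, hf, rfl⟩ := hM.exists_rowSelection
    obtain ⟨g, hg, rfl⟩ := hN.exists_rowSelection
    exact exists_iso_image_eq_iff hf hg

theorem nimis_thin_cylinder_three_by_n (n : ℕ) (hn : 2 ≤ n) :
    (nimisCard (thinCylinder 3 n) : ℚ) =
      2 ^ ((n : ℤ) - 3) + 2 ^ (⌈(((n : ℚ) - 4) / 2)⌉) := by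
  obtain ⟨k, rfl⟩ := Nat.exists_eq_add_of_le' hn
  have h : (2 : ℚ) * nimisCard (thinCylinder 3 (k + 2)) = 2 ^ k + 2 ^ ((k + 1) / 2) := by
    exact_mod_cast two_mul_nimisCard_thinCylinder_three k
  have hceil : ⌈(((k + 2 : ℕ) : ℚ) - 4) / 2⌉ = (((k + 1) / 2 : ℕ) : ℤ) - 1 := by
    rw [Int.ceil_eq_iff]
    rcases Nat.even_or_odd' k with ⟨m, rfl | rfl⟩
    · rw [show (2 * m + 1) / 2 = m by omega]
      push_cast
      constructor <;> linarith
    · rw [show (2 * m + 1 + 1) / 2 = m + 1 by omega]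
      push_cast
      constructor <;> linarith
  rw [hceil, show (((k + 2 : ℕ) : ℤ) - 3) = (k : ℤ) - 1 by push_cast; ring,
    zpow_sub_one₀ two_ne_zero, zpow_sub_one₀ two_ne_zero, zpow_natCast, zpow_natCast]
  linarith
end

section
/- Let H be a graph containing at least one edge and let n ≥ 2. Then every maximal independent set M of the box product H □ P_n (respectively H □ C_n) has nonempty intersection with the union of any two adjacent slices; that is, for every pair of adjacent indices i, i+1 of P_n (respectively adjacent indices of C_n), M contains at least one vertex whose second coordinate is i or i+1. -/
open SimpleGraph Finset

/-- A maximal independent set of a simple graph, as a set of vertices. -/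
def IsMaxIndepSet {V : Type*} (G : SimpleGraph V) (M : Set V) : Prop :=
  (∀ ⦃u⦄, u ∈ M → ∀ ⦃v⦄, v ∈ M → ¬ G.Adj u v) ∧
  ∀ N : Set V, (∀ ⦃u⦄, u ∈ N → ∀ ⦃v⦄, v ∈ N → ¬ G.Adj u v) → M ⊆ N → M = N

theorem IsMaxIndepSet.exists_adj {V : Type*} {G : SimpleGraph V} {M : Set V}
    (hM : IsMaxIndepSet G M) {v : V} (hv : v ∉ M) : ∃ w ∈ M, G.Adj v w := by
  by_contra! h
  have hins : M = insert v M := by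
    refine hM.2 _ ?_ (Set.subset_insert v M)
    rintro a (rfl | ha) b (rfl | hb)
    · exact G.irrefl
    · exact h b hb
    · exact fun hab => h a ha hab.symm
    · exact hM.1 ha hb
  exact hv (hins ▸ Set.mem_insert v M)

/-- If `i` has at most one neighbour other than `j`, then a maximal independent set of the box
product with a graph having an edge meets the slices over `i` and `j`. -/
theorem IsMaxIndepSet.exists_mem_slices {V W : Type*} {H : SimpleGraph V} {G : SimpleGraph W}
    {M : Set (V × W)} (hM : IsMaxIndepSet (H □ G) M) (hH : ∃ u v : V, H.Adj u v) {i j : W}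
    (hG : ∀ k l, G.Adj i k → G.Adj i l → k ≠ j → l ≠ j → k = l) :
    ∃ p ∈ M, p.2 = i ∨ p.2 = j := by
  by_contra! h
  obtain ⟨u, v, huv⟩ := hH
  have dominated (x : V) : ∃ k, (x, k) ∈ M ∧ G.Adj i k ∧ k ≠ j := by
    obtain ⟨⟨y, k⟩, hk, hadj⟩ := hM.exists_adj (v := (x, i)) fun hx => (h _ hx).1 rfl
    rcases boxProd_adj.1 hadj with ⟨-, hik⟩ | ⟨hik, hxy⟩
    · exact absurd hik.symm (h _ hk).1
    · obtain rfl : x = y := hxy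
      exact ⟨k, hk, hik, (h _ hk).2⟩
  obtain ⟨k, hk, hik, hkj⟩ := dominated u
  obtain ⟨l, hl, hil, hlj⟩ := dominated v
  obtain rfl := hG k l hik hil hkj hlj
  exact hM.1 hk hl (boxProd_adj.2 (Or.inl ⟨huv, rfl⟩))

theorem pathGraph_eq_of_adj_of_ne {n : ℕ} {i j k l : Fin n} (hj : (pathGraph n).Adj i j)
    (hk : (pathGraph n).Adj i k) (hl : (pathGraph n).Adj i l) (hkj : k ≠ j) (hlj : l ≠ j) :
    k = l := by
  rw [pathGraph_adj] at hj hk hl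
  lia

theorem cycleGraph_eq_of_adj_of_ne {n : ℕ} {i j k l : Fin (n + 2)}
    (hj : (cycleGraph (n + 2)).Adj i j) (hk : (cycleGraph (n + 2)).Adj i k)
    (hl : (cycleGraph (n + 2)).Adj i l) (hkj : k ≠ j) (hlj : l ≠ j) : k = l := by
  have key {m : Fin (n + 2)} (hm : (cycleGraph (n + 2)).Adj i m) : m = i - 1 ∨ m = i + 1 :=
    (cycleGraph_adj.1 hm).imp (fun h => by rw [← h, sub_sub_cancel])
      (fun h => by rw [← h, add_sub_cancel])
  grind [key hj, key hk, key hl]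

theorem mis_meets_adjacent_slices {V : Type*} (H : SimpleGraph V)
    (hH : ∃ u v : V, H.Adj u v) (n : ℕ) (hn : 2 ≤ n) :
    (∀ M : Set (V × Fin n), IsMaxIndepSet (H □ pathGraph n) M →
      ∀ i j : Fin n, (pathGraph n).Adj i j → ∃ p ∈ M, p.2 = i ∨ p.2 = j) ∧
    (∀ M : Set (V × Fin n), IsMaxIndepSet (H □ cycleGraph n) M →
      ∀ i j : Fin n, (cycleGraph n).Adj i j → ∃ p ∈ M, p.2 = i ∨ p.2 = j) := by
  refine ⟨fun M hM i j hij => hM.exists_mem_slices hH fun k l hk hl =>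
    pathGraph_eq_of_adj_of_ne hij hk hl, ?_⟩
  obtain ⟨m, rfl⟩ := Nat.exists_eq_add_of_le' hn
  exact fun M hM i j hij => hM.exists_mem_slices hH fun k l hk hl =>
    cycleGraph_eq_of_adj_of_ne hij hk hl
end

section
/- For all integers m, n ≥ 2, the number of maximal independent sets of the grid Möbius strip M_{m×n} is even. -/
open SimpleGraph Finset

/-- The grid Möbius strip `M_{m×n}` on vertex set `Fin n × Fin m` (0-indexed version of
`{1,…,n} × {1,…,m}`): edges at Manhattan distance 1, plus the twisted wrap-around edges
joining `(1,i)` to `(n, m+1-i)`. -/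
def mobiusGraph (m n : ℕ) : SimpleGraph (Fin n × Fin m) :=
  SimpleGraph.fromRel (fun p q =>
    ((p.1 : ℕ) + 1 = (q.1 : ℕ) ∧ p.2 = q.2) ∨
    (p.1 = q.1 ∧ (p.2 : ℕ) + 1 = (q.2 : ℕ)) ∨
    ((p.1 : ℕ) = 0 ∧ (q.1 : ℕ) = n - 1 ∧ (p.2 : ℕ) + (q.2 : ℕ) = m - 1))

/-- Every vertex outside a maximal independent set has a neighbour in it. -/
theorem IsMaxIndep.exists_adj {V : Type*} {G : SimpleGraph V} {s : Finset V}
    (hs : IsMaxIndep G s) {v : V} (hv : v ∉ s) : ∃ u ∈ s, G.Adj v u := by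
  classical
  by_contra! h
  have hind : ∀ ⦃a⦄, a ∈ insert v s → ∀ ⦃b⦄, b ∈ insert v s → ¬ G.Adj a b := by
    intro a ha b hb hab
    rcases Finset.mem_insert.mp ha with hav | ha <;> rcases Finset.mem_insert.mp hb with hbv | hb
    · exact hab.ne (hav.trans hbv.symm)
    · exact h b hb (hav ▸ hab)
    · exact h a ha (hbv ▸ hab.symm)
    · exact hs.1 ha hb hab
  exact hv (hs.2 _ hind (Finset.subset_insert v s) ▸ Finset.mem_insert_self v s)

/-- Independent dominating sets are maximal independent. -/
theorem IsMaxIndep.of_exists_adj {V : Type*} {G : SimpleGraph V} {s : Finset V}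
    (hind : ∀ ⦃u⦄, u ∈ s → ∀ ⦃v⦄, v ∈ s → ¬ G.Adj u v)
    (hdom : ∀ v ∉ s, ∃ u ∈ s, G.Adj v u) : IsMaxIndep G s := by
  refine ⟨hind, fun t ht hst => hst.antisymm fun v hv => ?_⟩
  by_contra hvs
  obtain ⟨u, hu, huv⟩ := hdom v hvs
  exact ht hv (hst hu) huv

/-- Graph automorphisms preserve maximal independent sets. -/
theorem IsMaxIndep.map {V : Type*} {G : SimpleGraph V} {s : Finset V}
    (hs : IsMaxIndep G s) (e : G ≃g G) : IsMaxIndep G (s.map e.toEquiv.toEmbedding) := by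
  refine .of_exists_adj ?_ fun v hv => ?_
  · simp only [Finset.mem_map]
    rintro _ ⟨u, hu, rfl⟩ _ ⟨v, hv, rfl⟩ h
    exact hs.1 hu hv (e.map_adj_iff.mp h)
  · have hv' : e.symm v ∉ s := fun h => hv (Finset.mem_map.mpr ⟨_, h, e.apply_symm_apply v⟩)
    obtain ⟨u, hu, hadj⟩ := hs.exists_adj hv'
    refine ⟨e u, Finset.mem_map_of_mem _ hu, ?_⟩
    simpa using e.map_adj_iff.mpr hadj

/-- If an involutive automorphism fixes no maximal independent set, then the number of maximal
independent sets is even. -/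
theorem even_card_misFinset_of_involutive {V : Type*} [Fintype V] {G : SimpleGraph V}
    (e : G ≃g G) (he : Function.Involutive e)
    (hfix : ∀ s, IsMaxIndep G s → s.map e.toEquiv.toEmbedding ≠ s) :
    Even (misFinset G).card := by
  classical
  have hmem : ∀ s, s ∈ misFinset G ↔ IsMaxIndep G s := by simp [misFinset]
  have hsum : ∑ _s ∈ misFinset G, (1 : ZMod 2) = 0 := by
    refine Finset.sum_involution (fun s _ => s.map e.toEquiv.toEmbedding)
      (fun _ _ => by decide) (fun s hs _ => hfix s ((hmem s).mp hs))
      (fun s hs => (hmem _).mpr (((hmem s).mp hs).map e)) (fun s _ => ?_)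
    ext v
    simp only [Finset.map_map, Finset.mem_map]
    constructor
    · rintro ⟨u, hu, rfl⟩
      simpa using (he u).symm ▸ hu
    · exact fun hv => ⟨v, hv, he v⟩
  rw [Finset.sum_const, nsmul_one] at hsum
  exact (ZMod.natCast_eq_zero_iff_even).mp hsum

theorem mobiusGraph_adj_rev {m n : ℕ} {p q : Fin n × Fin m} (h : (mobiusGraph m n).Adj p q) :
    (mobiusGraph m n).Adj (p.1.rev, p.2.rev) (q.1.rev, q.2.rev) := by
  obtain ⟨⟨a, ha⟩, ⟨b, hb⟩⟩ := p
  obtain ⟨⟨c, hc⟩, ⟨d, hd⟩⟩ := q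
  simp only [mobiusGraph, SimpleGraph.fromRel_adj, ne_eq, Prod.mk.injEq, Fin.ext_iff,
    Fin.val_rev] at h ⊢
  obtain ⟨hne, (h | h | h) | (h | h | h)⟩ := h
  · exact ⟨by omega, .inr (.inl (by omega))⟩
  · exact ⟨by omega, .inr (.inr (.inl (by omega)))⟩
  · exact ⟨by omega, .inr (.inr (.inr (by omega)))⟩
  · exact ⟨by omega, .inl (.inl (by omega))⟩
  · exact ⟨by omega, .inl (.inr (.inl (by omega)))⟩
  · exact ⟨by omega, .inl (.inr (.inr (by omega)))⟩

/-- The half-turn `(i, j) ↦ (n - 1 - i, m - 1 - j)` of the Möbius strip. -/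
def mobiusHalfTurn (m n : ℕ) : mobiusGraph m n ≃g mobiusGraph m n where
  toEquiv := Fin.revPerm.prodCongr Fin.revPerm
  map_rel_iff' := by
    refine fun {p q} => ⟨fun h => ?_, mobiusGraph_adj_rev⟩
    simpa using mobiusGraph_adj_rev h

/-- No maximal independent set is invariant under the half-turn: it would avoid the first and
last columns, so it would contain the whole second column. -/
theorem map_mobiusHalfTurn_ne {m n : ℕ} (hm : 2 ≤ m) (hn : 2 ≤ n) (s : Finset (Fin n × Fin m))
    (hs : IsMaxIndep (mobiusGraph m n) s) :
    s.map (mobiusHalfTurn m n).toEquiv.toEmbedding ≠ s := by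
  intro hfix
  have hrev : ∀ p ∈ s, (p.1.rev, p.2.rev) ∈ s := fun p hp =>
    hfix ▸ Finset.mem_map_of_mem (mobiusHalfTurn m n).toEquiv.toEmbedding hp
  have hfirst : ∀ p ∈ s, (p.1 : ℕ) ≠ 0 := by
    intro p hp h0
    refine hs.1 hp (hrev p hp) ?_
    simp only [mobiusGraph, SimpleGraph.fromRel_adj, ne_eq, Prod.ext_iff, Fin.ext_iff, Fin.val_rev]
    omega
  have hlast : ∀ p ∈ s, (p.1 : ℕ) ≠ n - 1 := by
    intro p hp h
    refine hfirst _ (hrev p hp) ?_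
    simp only [Fin.val_rev]
    omega
  have hsecond : ∀ j : Fin m, ((⟨1, hn⟩, j) : Fin n × Fin m) ∈ s := by
    intro j
    obtain ⟨⟨c, d⟩, hu, hadj⟩ := hs.exists_adj (v := ((⟨0, by omega⟩, j) : Fin n × Fin m))
      fun h => hfirst _ h rfl
    have h0 := hfirst _ hu
    have h1 := hlast _ hu
    simp only [mobiusGraph, SimpleGraph.fromRel_adj, ne_eq, Prod.ext_iff, Fin.ext_iff] at h0 h1 hadj
    have hcd : (c, d) = ((⟨1, hn⟩, j) : Fin n × Fin m) := by
      simp only [Prod.ext_iff, Fin.ext_iff]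
      omega
    exact hcd ▸ hu
  refine hs.1 (hsecond ⟨0, by omega⟩) (hsecond ⟨1, hm⟩) ?_
  simp [mobiusGraph]

theorem mis_mobius_even (m n : ℕ) (hm : 2 ≤ m) (hn : 2 ≤ n) :
    Even (misFinset (mobiusGraph m n)).card := by
  refine even_card_misFinset_of_involutive (mobiusHalfTurn m n) (fun p => ?_)
    (map_mobiusHalfTurn_ne hm hn)
  exact Prod.ext (Fin.rev_rev p.1) (Fin.rev_rev p.2)
end

section
/- For every integer n ≥ 1, the number of maximal independent sets of the grid graph G_{2×n} equals 2·F(n). -/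
open SimpleGraph Finset

/-- A finset is a maximal independent set iff it consists of exactly the vertices having no
neighbour in it. -/
theorem isMaxIndep_iff_mem_iff {V : Type*} (G : SimpleGraph V) (s : Finset V) :
    IsMaxIndep G s ↔ ∀ v, v ∈ s ↔ ∀ u ∈ s, ¬ G.Adj v u := by
  classical
  constructor
  · rintro ⟨hind, hmax⟩ v
    refine ⟨fun hv u hu => hind hv hu, fun hv => ?_⟩
    rw [hmax (insert v s) ?_ (Finset.subset_insert v s)]
    · exact Finset.mem_insert_self v s
    · intro a ha b hb
      rcases Finset.mem_insert.1 ha with rfl | has <;> rcases Finset.mem_insert.1 hb with rfl | hbs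
      · exact G.irrefl
      · exact hv b hbs
      · exact fun h => hv a has h.symm
      · exact hind has hbs
  · intro h
    refine ⟨fun u hu v hv => (h u).1 hu v hv, fun t ht hst => hst.antisymm fun v hv => ?_⟩
    exact (h v).2 fun u hu => ht hv (hst hu)

/-- The sequence obtained by putting `x` in front of `w`. -/
def seqCons {α : Type*} (x : α) (w : ℕ → α) : ℕ → α
  | 0 => x
  | i + 1 => w i

theorem seqCons_injective {α : Type*} (x : α) : Function.Injective (seqCons x) :=
  fun _ _ h => funext fun i => congrFun h (i + 1)

theorem seqCons_shift {α : Type*} (w : ℕ → α) : seqCons (w 0) (fun i => w (i + 1)) = w := by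
  funext i
  cases i <;> rfl

/-- `w` records the columns `0, …, m` of a subset of the ladder with `m + 1` rungs, where each
column holds at most one vertex; the condition says that the subset is a maximal independent set.
Columns beyond `m` are empty. -/
structure IsColumnSeq (m : ℕ) (w : ℕ → Option (Fin 2)) : Prop where
  first : w 0 ≠ none
  last : w m ≠ none
  beyond : ∀ i, m < i → w i = none
  ne_succ : ∀ i < m, w i ≠ w (i + 1)
  ne_of_gap : ∀ i, i + 1 < m → w (i + 1) = none → w i ≠ w (i + 2)

theorem isColumnSeq_iff_kernel (m : ℕ) (w : ℕ → Option (Fin 2)) (hw : ∀ i, m < i → w i = none) :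
    IsColumnSeq m w ↔ ∀ i ≤ m, ∀ a : Fin 2, w i = some a ↔
      w i ≠ some a.rev ∧ w (i + 1) ≠ some a ∧ ∀ j, j + 1 = i → w j ≠ some a := by
  have two (x : Option (Fin 2)) : x = none ∨ x = some 0 ∨ x = some 1 := by
    revert x; decide
  have r0 : (0 : Fin 2).rev = 1 := rfl
  have r1 : (1 : Fin 2).rev = 0 := rfl
  constructor
  · rintro ⟨h0, hm, hb, hs, hg⟩ i hi a
    have := two (w i)
    have := two (w (i + 1))
    have ha : a = 0 ∨ a = 1 := by omega
    rcases i with _ | i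
    · grind
    · have := two (w i)
      rcases ha with rfl | rfl <;> grind
  · intro h
    have key (i) (hi : i ≤ m) := And.intro (h i hi 0) (h i hi 1)
    rw [r0, r1] at key
    refine ⟨?_, ?_, hw, ?_, ?_⟩
    · have := key 0 (by omega)
      have := two (w 1)
      grind
    · have := key m le_rfl
      rcases m with _ | m
      · grind
      · have := two (w m)
        have := hw (m + 2) (by omega)
        grind
    · intro i hi
      have := key i hi.le
      have := key (i + 1) hi
      have := two (w i)
      have := two (w (i + 1))
      have := two (w (i + 2))
      rcases i with _ | i
      · grind
      · have := two (w i)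
        grind
    · intro i hi hn
      have := key (i + 1) hi.le
      have := two (w i)
      have := two (w (i + 2))
      grind

open scoped Classical in
/-- The column sequences of maximal independent sets of the ladder with `m + 1` rungs whose first
column is `b`. -/
noncomputable def columnSeqs : ℕ → Fin 2 → Finset (ℕ → Option (Fin 2))
  | 0, b => {seqCons (some b) fun _ => none}
  | 1, b => (columnSeqs 0 b.rev).map ⟨_, seqCons_injective (some b)⟩
  | m + 2, b =>
    (columnSeqs (m + 1) b.rev).map ⟨_, seqCons_injective (some b)⟩ ∪
      (columnSeqs m b.rev).map
        ⟨seqCons (some b) ∘ seqCons none, (seqCons_injective _).comp (seqCons_injective _)⟩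

theorem isColumnSeq_seqCons_some (m : ℕ) (b c : Fin 2) (w : ℕ → Option (Fin 2))
    (hc : w 0 = some c) :
    IsColumnSeq (m + 1) (seqCons (some b) w) ↔ c = b.rev ∧ IsColumnSeq m w := by
  have hcb : c = b.rev ↔ b ≠ c := by clear hc; revert b c; decide
  rw [hcb]
  constructor
  · rintro ⟨-, h₂, h₃, h₄, h₅⟩
    refine ⟨fun h => h₄ 0 (by omega) (by simp [seqCons, hc, h]), by simp [hc], h₂,
      fun i hi => h₃ (i + 1) (by omega), fun i hi => h₄ (i + 1) (by omega),
      fun i hi => h₅ (i + 1) (by omega)⟩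
  · rintro ⟨h, h₁, h₂, h₃, h₄, h₅⟩
    refine ⟨by simp [seqCons], h₂, ?_, ?_, ?_⟩ <;> rintro (_ | i) hi
    · omega
    · exact h₃ i (by omega)
    · simpa [seqCons, hc] using h
    · exact h₄ i (by omega)
    · simp [seqCons, hc]
    · exact h₅ i (by omega)

theorem isColumnSeq_seqCons_none (m : ℕ) (b : Fin 2) (w : ℕ → Option (Fin 2)) :
    IsColumnSeq (m + 2) (seqCons (some b) (seqCons none w)) ↔
      w 0 = some b.rev ∧ IsColumnSeq m w := by
  have hwb : w 0 = some b.rev ↔ w 0 ≠ none ∧ some b ≠ w 0 := by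
    generalize w 0 = x
    revert b x
    decide
  rw [hwb]
  constructor
  · rintro ⟨-, h₂, h₃, h₄, h₅⟩
    have h₁ : w 0 ≠ none := fun h => h₄ 1 (by omega) h.symm
    refine ⟨⟨h₁, h₅ 0 (by omega) rfl⟩, h₁, h₂,
      fun i hi => h₃ (i + 2) (by omega), fun i hi => h₄ (i + 2) (by omega),
      fun i hi => h₅ (i + 2) (by omega)⟩
  · rintro ⟨⟨h₀, h⟩, h₁, h₂, h₃, h₄, h₅⟩
    refine ⟨by simp [seqCons], h₂, ?_, ?_, ?_⟩ <;> rintro (_ | _ | i) hi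
    · omega
    · omega
    · exact h₃ i (by omega)
    · simp [seqCons]
    · exact h₀.symm
    · exact h₄ i (by omega)
    · exact fun _ => h
    · exact fun h' => absurd h' h₀
    · exact h₅ i (by omega)

theorem mem_columnSeqs (m : ℕ) (b : Fin 2) (w : ℕ → Option (Fin 2)) :
    w ∈ columnSeqs m b ↔ w 0 = some b ∧ IsColumnSeq m w := by
  induction m using Nat.twoStepInduction generalizing b w with
  | zero =>
    rw [columnSeqs, Finset.mem_singleton]
    constructor
    · rintro rfl
      refine ⟨rfl, by simp [seqCons], by simp [seqCons], ?_, by simp, by simp⟩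
      rintro (_ | i) hi
      · omega
      · rfl
    · rintro ⟨h, hw⟩
      funext i
      cases i with
      | zero => exact h
      | succ i => exact hw.beyond _ (by omega)
  | one =>
    simp only [columnSeqs, Finset.map_singleton, Finset.mem_singleton,
      Function.Embedding.coeFn_mk]
    constructor
    · rintro rfl
      refine ⟨rfl, by simp [seqCons], by simp [seqCons], ?_, ?_, by omega⟩
      · rintro (_ | _ | i) hi
        exacts [by omega, by omega, rfl]
      · rintro i hi
        obtain rfl : i = 0 := by omega
        have : b ≠ b.rev := by revert b; decide
        simpa [seqCons] using this
    · rintro ⟨h, hw⟩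
      obtain ⟨c, hc⟩ := Option.ne_none_iff_exists'.1 hw.last
      have hne := hw.ne_succ 0 one_pos
      have hcb : c = b.rev := by
        rw [h, zero_add, hc, Ne, Option.some_inj] at hne
        clear hc h
        revert b c
        decide
      funext i
      rcases i with _ | _ | i
      exacts [h, hcb ▸ hc, hw.beyond _ (by omega)]
  | more m ih₀ ih₁ =>
    simp only [columnSeqs, Finset.mem_union, Finset.mem_map, Function.Embedding.coeFn_mk, ih₀, ih₁,
      Function.comp_apply]
    constructor
    · rintro (⟨u, ⟨hu, h⟩, rfl⟩ | ⟨u, ⟨hu, h⟩, rfl⟩)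
      · exact ⟨rfl, (isColumnSeq_seqCons_some _ _ _ _ hu).2 ⟨rfl, h⟩⟩
      · exact ⟨rfl, (isColumnSeq_seqCons_none _ _ _).2 ⟨hu, h⟩⟩
    · rintro ⟨h, hw⟩
      rcases h₁ : w 1 with _ | c
      · right
        have hcons : seqCons (some b) (seqCons none fun i => w (i + 2)) = w := by
          funext i
          rcases i with _ | _ | i
          exacts [h.symm, h₁.symm, rfl]
        exact ⟨_, (isColumnSeq_seqCons_none _ _ _).1 (hcons.symm ▸ hw), hcons⟩
      · left
        have hcons : seqCons (some b) (fun i => w (i + 1)) = w := h ▸ seqCons_shift w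
        obtain ⟨rfl, hw'⟩ := (isColumnSeq_seqCons_some m.succ b c _ h₁).1 (hcons.symm ▸ hw)
        exact ⟨_, ⟨h₁, hw'⟩, hcons⟩

theorem card_columnSeqs (m : ℕ) (b : Fin 2) : (columnSeqs m b).card = Nat.fib (m + 1) := by
  classical
  induction m using Nat.twoStepInduction generalizing b with
  | zero => simp [columnSeqs]
  | one => simp [columnSeqs]
  | more m ih₀ ih₁ =>
    rw [columnSeqs, Finset.card_union_of_disjoint, Finset.card_map, Finset.card_map, ih₀, ih₁,
      Nat.fib_add_two (n := m + 1), add_comm]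
    rw [Finset.disjoint_left]
    simp only [Finset.mem_map, mem_columnSeqs, Function.Embedding.coeFn_mk, not_exists, not_and]
    rintro _ ⟨u, ⟨hu, -⟩, rfl⟩ v - h
    have := congrFun h 1
    simp_all [seqCons]

theorem isMaxIndep_filter_iff (m : ℕ) (w : ℕ → Option (Fin 2)) (hw : ∀ i, m < i → w i = none) :
    IsMaxIndep (gridGraph 2 (m + 1))
      (Finset.univ.filter fun p : Fin 2 × Fin (m + 1) => w p.2 = some p.1) ↔ IsColumnSeq m w := by
  have hrev (a c : Fin 2) : (a : ℕ) + 1 = c ∨ (c : ℕ) + 1 = a ↔ c = a.rev := by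
    revert a c; decide
  rw [isMaxIndep_iff_mem_iff, isColumnSeq_iff_kernel m w hw]
  simp only [Finset.mem_filter, Finset.mem_univ, true_and, Prod.forall, gridGraph, boxProd_adj,
    pathGraph_adj, hrev]
  constructor
  · intro h i hi a
    rw [h a ⟨i, by omega⟩]
    constructor
    · intro h'
      refine ⟨fun hr => h' a.rev ⟨i, by omega⟩ hr (by simp), fun hr => ?_, fun j hj hr => ?_⟩
      · by_cases him : i + 1 < m + 1
        · exact h' a ⟨i + 1, him⟩ hr (by simp)
        · simp [hw (i + 1) (by omega)] at hr
      · exact h' a ⟨j, by omega⟩ hr (by simp [hj])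
    · rintro ⟨h₁, h₂, h₃⟩ c ⟨j, hj⟩ hc (⟨rfl, h⟩ | ⟨h | h, rfl⟩)
      · simp_all
      · simp_all
      · exact h₃ j h hc
  · intro h a i
    rw [h i (by omega) a]
    constructor
    · rintro ⟨h₁, h₂, h₃⟩ c j hc (⟨rfl, h⟩ | ⟨h | h, rfl⟩)
      · simp_all
      · simp_all
      · exact h₃ j h hc
    · intro h'
      refine ⟨fun hr => h' a.rev i hr (by simp), fun hr => ?_, fun j hj hr => ?_⟩
      · by_cases him : (i : ℕ) + 1 < m + 1
        · exact h' a ⟨i + 1, him⟩ hr (by simp)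
        · simp [hw (i + 1) (by omega)] at hr
      · exact h' a ⟨j, by omega⟩ hr (by simp [hj])

/-- A maximal independent set of the ladder is recorded by its sequence of columns. -/
theorem exists_columns_of_isMaxIndep (m : ℕ) (s : Finset (Fin 2 × Fin (m + 1)))
    (hs : IsMaxIndep (gridGraph 2 (m + 1)) s) :
    ∃ w : ℕ → Option (Fin 2), (∀ i, m < i → w i = none) ∧
      (Finset.univ.filter fun p : Fin 2 × Fin (m + 1) => w p.2 = some p.1) = s := by
  classical
  refine ⟨fun i => if h : i < m + 1 then
    if (0, ⟨i, h⟩) ∈ s then some 0 else if (1, ⟨i, h⟩) ∈ s then some 1 else none else none,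
    fun i hi => dif_neg (by omega), ?_⟩
  ext ⟨a, i⟩
  have hadj : (0, i) ∈ s → (1, i) ∉ s := fun h₀ h₁ =>
    hs.1 h₀ h₁ (by simp [gridGraph, boxProd_adj, pathGraph_adj])
  have ha : a = 0 ∨ a = 1 := by omega
  rcases ha with rfl | rfl <;> by_cases h₀ : (0, i) ∈ s <;> by_cases h₁ : (1, i) ∈ s <;>
    simp_all [Nat.le_of_lt_succ i.isLt]

theorem mis_grid_two_by_n_card (n : ℕ) (hn : 1 ≤ n) :
    (misFinset (gridGraph 2 n)).card = 2 * Nat.fib n := by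
  classical
  obtain ⟨m, rfl⟩ := Nat.exists_eq_add_of_le' hn
  have hcard : (Finset.univ.biUnion (columnSeqs m)).card = 2 * Nat.fib (m + 1) := by
    rw [Finset.card_biUnion, Finset.sum_congr rfl fun b _ => card_columnSeqs m b]
    · simp
    · intro b _ c _ hbc
      refine Finset.disjoint_left.2 fun w hb hc => ?_
      rw [mem_columnSeqs] at hb hc
      exact hbc (Option.some_injective _ (hb.1.symm.trans hc.1))
  have hmem (w : ℕ → Option (Fin 2)) :
      w ∈ Finset.univ.biUnion (columnSeqs m) ↔ IsColumnSeq m w := by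
    simp only [Finset.mem_biUnion, Finset.mem_univ, true_and, mem_columnSeqs, exists_and_right]
    exact and_iff_right_of_imp fun h => (Option.ne_none_iff_exists'.1 h.first)
  rw [← hcard]
  symm
  refine Finset.card_bij
    (fun w _ => Finset.univ.filter fun p : Fin 2 × Fin (m + 1) => w p.2 = some p.1) ?_ ?_ ?_
  · intro w hw
    rw [hmem] at hw
    simpa [misFinset] using (isMaxIndep_filter_iff m w hw.beyond).2 hw
  · intro u hu w hw huw
    rw [hmem] at hu hw
    funext i
    by_cases hi : m < i
    · rw [hu.beyond i hi, hw.beyond i hi]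
    · refine Option.ext fun a => ?_
      simpa using Finset.ext_iff.1 huw (a, ⟨i, by omega⟩)
  · intro s hs
    have hs' : IsMaxIndep (gridGraph 2 (m + 1)) s := by simpa [misFinset] using hs
    obtain ⟨w, hw, rfl⟩ := exists_columns_of_isMaxIndep m s hs'
    exact ⟨w, (hmem w).2 ((isMaxIndep_filter_iff m w hw).1 hs'), rfl⟩
end

section
/- For the grid graph G_{2×n}, define ψ(M) ∈ {0,1}^n for a maximal independent set M by ψ(M)(i) = |M ∩ {(i,1),(i,2)}|. Then for every maximal independent set M, the string ψ(M) has no two adjacent 0's and its first and last bits equal 1; moreover, every length-n binary string with these properties is the image under ψ of exactly two maximal independent sets M, M' of G_{2×n}, and these satisfy M' = h(M), where h is the automorphism swapping the two rows (h(i,1)=(i,2), h(i,2)=(i,1)). -/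
open SimpleGraph Finset

/-- The string `ψ(M)`: its `i`-th bit records how many vertices of `M` lie in the
`i`-th slice `{(1,i),(2,i)}` of the `2 × n` grid (rows are the `Fin 2` coordinate). -/
def psiG {n : ℕ} (M : Finset (Fin 2 × Fin n)) (i : Fin n) : ℕ :=
  (M.filter (fun p => p.2 = i)).card

/-- The row-swapping automorphism `h` of the `2 × n` grid. -/
def rowSwap {n : ℕ} (p : Fin 2 × Fin n) : Fin 2 × Fin n := (p.1.rev, p.2)

/-- A finset is a maximal independent set iff it is a kernel: its members are exactly the
vertices with no neighbour in it. -/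
theorem isMaxIndep_iff_forall_mem {V : Type*} [DecidableEq V] {G : SimpleGraph V} {s : Finset V} :
    IsMaxIndep G s ↔ ∀ v, v ∈ s ↔ ∀ u, G.Adj v u → u ∉ s := by
  constructor
  · rintro ⟨hind, hmax⟩ v
    refine ⟨fun hv u huv hu => hind hv hu huv, fun hv => ?_⟩
    rw [hmax (insert v s) ?_ (Finset.subset_insert v s)]
    · exact Finset.mem_insert_self v s
    · intro u hu w hw
      rcases Finset.mem_insert.1 hu with rfl | hus <;> rcases Finset.mem_insert.1 hw with rfl | hws
      · exact G.loopless.irrefl _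
      · exact fun h => hv w h hws
      · exact fun h => hv u h.symm hus
      · exact hind hus hws
  · intro h
    refine ⟨fun u hu v hv huv => (h u).1 hu v huv hv, fun t ht hst => ?_⟩
    exact hst.antisymm fun v hv => (h v).2 fun u huv hu => ht hv (hst hu) huv

theorem isMaxIndep_grid_iff {n : ℕ} {M : Finset (Fin 2 × Fin n)} :
    IsMaxIndep (gridGraph 2 n) M ↔ ∀ r i, (r, i) ∈ M ↔
      (r.rev, i) ∉ M ∧ ∀ j : Fin n, i.val + 1 = j.val ∨ j.val + 1 = i.val → (r, j) ∉ M := by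
  have hrev : ∀ r q : Fin 2, (r.val + 1 = q.val ∨ q.val + 1 = r.val) ↔ q = r.rev := by decide
  simp only [isMaxIndep_iff_forall_mem, Prod.forall, gridGraph, boxProd_adj, pathGraph_adj, hrev]
  refine forall₂_congr fun r i => iff_congr Iff.rfl ⟨fun h => ?_, ?_⟩
  · exact ⟨h _ _ (.inl ⟨rfl, rfl⟩), fun j hj => h _ _ (.inr ⟨hj, rfl⟩)⟩
  · rintro ⟨h₁, h₂⟩ q j (⟨rfl, rfl⟩ | ⟨hj, rfl⟩)
    exacts [h₁, h₂ j hj]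

theorem psiG_eq_sum {n : ℕ} (M : Finset (Fin 2 × Fin n)) (i : Fin n) :
    psiG M i = (if (0, i) ∈ M then 1 else 0) + if (1, i) ∈ M then 1 else 0 := by
  have h : M.filter (fun p => p.2 = i) =
      (Finset.univ.filter fun r => (r, i) ∈ M).image fun r => (r, i) := by
    ext ⟨r, j⟩
    simp only [Finset.mem_filter, Finset.mem_image, Finset.mem_univ, true_and, Prod.mk.injEq]
    grind
  rw [psiG, h, Finset.card_image_of_injective _ (Prod.mk_left_injective i), Finset.card_filter,
    Fin.sum_univ_two]

theorem psiG_eq_zero_iff {n : ℕ} {M : Finset (Fin 2 × Fin n)} {i : Fin n} :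
    psiG M i = 0 ↔ ∀ r, (r, i) ∉ M := by
  rw [psiG_eq_sum, Fin.forall_fin_two]
  split_ifs <;> simp_all

theorem IsMaxIndep.psiG_eq_one_iff {n : ℕ} {M : Finset (Fin 2 × Fin n)}
    (hM : IsMaxIndep (gridGraph 2 n) M) {i : Fin n} (r : Fin 2) :
    psiG M i = 1 ↔ ((r, i) ∈ M ↔ (r.rev, i) ∉ M) := by
  have h := ((isMaxIndep_grid_iff.1 hM 0 i).1 · |>.1)
  rw [psiG_eq_sum]
  change (_ → (1, i) ∉ M) at h
  fin_cases r
  · change _ ↔ ((0, i) ∈ M ↔ (1, i) ∉ M)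
    grind
  · change _ ↔ ((1, i) ∈ M ↔ (0, i) ∉ M)
    grind

theorem IsMaxIndep.psiG_eq_zero_or_one {n : ℕ} {M : Finset (Fin 2 × Fin n)}
    (hM : IsMaxIndep (gridGraph 2 n) M) (i : Fin n) : psiG M i = 0 ∨ psiG M i = 1 := by
  have h := ((isMaxIndep_grid_iff.1 hM 0 i).1 · |>.1)
  rw [psiG_eq_sum]
  change (_ → (1, i) ∉ M) at h
  grind

/-- An empty slice lies strictly between two slices whose vertices are in opposite rows. -/
theorem IsMaxIndep.exists_of_psiG_eq_zero {n : ℕ} {M : Finset (Fin 2 × Fin n)}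
    (hM : IsMaxIndep (gridGraph 2 n) M) {i : Fin n} (hi : psiG M i = 0) :
    ∃ j k : Fin n, j.val + 1 = i.val ∧ i.val + 1 = k.val ∧
      ∃ r, (r, j) ∈ M ∧ (r.rev, k) ∈ M := by
  rw [psiG_eq_zero_iff] at hi
  rw [isMaxIndep_grid_iff] at hM
  have key : ∀ r, ∃ j : Fin n, (i.val + 1 = j.val ∨ j.val + 1 = i.val) ∧ (r, j) ∈ M := by
    intro r
    by_contra! hc
    exact hi r ((hM r i).2 ⟨hi _, hc⟩)
  have hne : ∀ {j k : Fin n}, j.val = k.val → (0, j) ∈ M → (1, k) ∉ M := by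
    intro j k hjk h
    rw [← Fin.ext hjk]
    exact ((hM 0 j).1 h).1
  obtain ⟨j, hj, hjM⟩ := key 0
  obtain ⟨k, hk, hkM⟩ := key 1
  rcases hj with hj | hj <;> rcases hk with hk | hk
  · exact absurd hkM (hne (by omega) hjM)
  · exact ⟨k, j, hk, hj, 1, hkM, hjM⟩
  · exact ⟨j, k, hj, hk, 0, hjM, hkM⟩
  · exact absurd hkM (hne (by omega) hjM)

theorem rowSwap_involutive {n : ℕ} : Function.Involutive (rowSwap (n := n)) := fun p => by
  simp [rowSwap]

theorem mem_image_rowSwap {n : ℕ} {M : Finset (Fin 2 × Fin n)} {r : Fin 2} {i : Fin n} :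
    (r, i) ∈ M.image rowSwap ↔ (r.rev, i) ∈ M := by
  rw [Finset.mem_image]
  constructor
  · rintro ⟨p, hp, h⟩
    have := congrArg rowSwap h
    rw [rowSwap_involutive p] at this
    rw [this] at hp
    exact hp
  · exact fun h => ⟨_, h, by simp [rowSwap]⟩

theorem IsMaxIndep.image_rowSwap {n : ℕ} {M : Finset (Fin 2 × Fin n)}
    (hM : IsMaxIndep (gridGraph 2 n) M) : IsMaxIndep (gridGraph 2 n) (M.image rowSwap) := by
  rw [isMaxIndep_grid_iff] at hM ⊢
  simp only [mem_image_rowSwap]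
  exact fun r i => hM r.rev i

theorem psiG_image_rowSwap {n : ℕ} (M : Finset (Fin 2 × Fin n)) (i : Fin n) :
    psiG (M.image rowSwap) i = psiG M i := by
  simp only [psiG_eq_sum, mem_image_rowSwap]
  exact add_comm _ _

/-- In a maximal independent set, consecutive occupied slices use opposite rows. -/
theorem IsMaxIndep.mem_succ_iff {n : ℕ} {M : Finset (Fin 2 × Fin n)}
    (hM : IsMaxIndep (gridGraph 2 n) M) {i j : Fin n} (hij : i.val + 1 = j.val)
    (hi : psiG M i = 1) (hj : psiG M j = 1) (r : Fin 2) : (r, j) ∈ M ↔ (r, i) ∉ M := by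
  have h₁ := (hM.psiG_eq_one_iff r).1 hi
  have h₂ := (hM.psiG_eq_one_iff r).1 hj
  rw [isMaxIndep_grid_iff] at hM
  have h₃ := fun h => ((hM r i).1 h).2 j (.inl hij)
  have h₄ := fun h => ((hM r.rev i).1 h).2 j (.inl hij)
  tauto

theorem IsMaxIndep.mem_add_two_iff {n : ℕ} {M : Finset (Fin 2 × Fin n)}
    (hM : IsMaxIndep (gridGraph 2 n) M) {i j k : Fin n} (hij : i.val + 1 = j.val)
    (hjk : j.val + 1 = k.val) (hj : psiG M j = 0) (r : Fin 2) : (r, k) ∈ M ↔ (r, i) ∉ M := by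
  obtain ⟨i', k', hi', hk', q, hqi, hqk⟩ := hM.exists_of_psiG_eq_zero hj
  obtain rfl : i' = i := Fin.ext (by omega)
  obtain rfl : k' = k := Fin.ext (by omega)
  rw [isMaxIndep_grid_iff] at hM
  have h₁ := ((hM q i').1 hqi).1
  have h₂ := ((hM q.rev k').1 hqk).1
  rw [Fin.rev_rev] at h₂
  have hr : ∀ r q : Fin 2, r = q ∨ r = q.rev := by decide
  rcases hr r q with rfl | rfl <;> tauto

/-- A maximal independent set is determined by its image under `ψ` and its first slice. -/
theorem IsMaxIndep.eq_of_psiG_eq {n : ℕ} {M N : Finset (Fin 2 × Fin n)}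
    (hM : IsMaxIndep (gridGraph 2 n) M) (hN : IsMaxIndep (gridGraph 2 n) N)
    (hψ : ∀ i, psiG M i = psiG N i)
    (h₀ : ∀ i : Fin n, i.val = 0 → ∀ r, (r, i) ∈ M ↔ (r, i) ∈ N) : M = N := by
  have key : ∀ i : ℕ, ∀ hi : i < n, ∀ r, (r, (⟨i, hi⟩ : Fin n)) ∈ M ↔ (r, ⟨i, hi⟩) ∈ N := by
    intro i
    induction i using Nat.strong_induction_on with
    | _ i ih =>
      intro hi r
      rcases i with _ | i
      · exact h₀ _ rfl r
      rcases hM.psiG_eq_zero_or_one ⟨i + 1, hi⟩ with h | h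
      · have h' := hψ _ ▸ h
        rw [psiG_eq_zero_iff] at h h'
        simp [h r, h' r]
      have hi' : i < n := by omega
      rcases hM.psiG_eq_zero_or_one ⟨i, hi'⟩ with hp | hp
      · obtain ⟨j, -, hj, -⟩ := hM.exists_of_psiG_eq_zero hp
        have hj' : j.val + 1 = i := hj
        rw [hM.mem_add_two_iff hj rfl hp, hN.mem_add_two_iff hj rfl (hψ _ ▸ hp)]
        exact not_congr (ih j (by omega) j.2 r)
      · rw [hM.mem_succ_iff (i := ⟨i, hi'⟩) rfl hp h,
          hN.mem_succ_iff (i := ⟨i, hi'⟩) rfl (hψ _ ▸ hp) (hψ _ ▸ h)]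
        exact not_congr (ih i (by omega) hi' r)
  ext ⟨r, i⟩
  exact key i i.2 r

/-- The set whose slices are occupied according to `b`, alternating between the two rows. -/
def alternatingSet {n : ℕ} (b : Fin n → ℕ) : Finset (Fin 2 × Fin n) :=
  Finset.univ.filter fun p => b p.2 = 1 ∧ (∑ j ∈ Finset.Iio p.2, b j) % 2 = p.1.val

theorem mem_alternatingSet {n : ℕ} {b : Fin n → ℕ} {r : Fin 2} {i : Fin n} :
    (r, i) ∈ alternatingSet b ↔ b i = 1 ∧ (∑ j ∈ Finset.Iio i, b j) % 2 = r.val := by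
  simp [alternatingSet]

theorem sum_Iio_of_add_one_eq {n : ℕ} (b : Fin n → ℕ) {i j : Fin n} (hij : i.val + 1 = j.val) :
    ∑ k ∈ Finset.Iio j, b k = b i + ∑ k ∈ Finset.Iio i, b k := by
  have h : Finset.Iio j = insert i (Finset.Iio i) := by
    ext k
    simp only [Finset.mem_Iio, Finset.mem_insert, Fin.lt_def, Fin.ext_iff]
    omega
  rw [h, Finset.sum_insert (by simp)]

theorem psiG_alternatingSet {n : ℕ} {b : Fin n → ℕ} (hb : ∀ i, b i = 0 ∨ b i = 1) (i : Fin n) :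
    psiG (alternatingSet b) i = b i := by
  simp only [psiG_eq_sum, mem_alternatingSet, Fin.val_zero, Fin.val_one]
  rcases hb i with h | h
  · simp [h]
  · rcases Nat.mod_two_eq_zero_or_one (∑ j ∈ Finset.Iio i, b j) with h' | h' <;> simp [h, h']

theorem isMaxIndep_alternatingSet {n : ℕ} {b : Fin n → ℕ} (hb : ∀ i, b i = 0 ∨ b i = 1)
    (hadj : ∀ i j : Fin n, i.val + 1 = j.val → b i = 1 ∨ b j = 1)
    (hfirst : ∀ i : Fin n, i.val = 0 → b i = 1)
    (hlast : ∀ i : Fin n, i.val + 1 = n → b i = 1) :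
    IsMaxIndep (gridGraph 2 n) (alternatingSet b) := by
  rw [isMaxIndep_grid_iff]
  intro r i
  simp only [mem_alternatingSet, Fin.val_rev]
  have hr := r.2
  constructor
  · rintro ⟨h₁, h₂⟩
    refine ⟨by omega, fun j hj => ?_⟩
    rcases hj with hj | hj
    · have := sum_Iio_of_add_one_eq b hj
      omega
    · have := sum_Iio_of_add_one_eq b hj
      omega
  · rintro ⟨h₁, h₂⟩
    rcases hb i with hi | hi
    · have hi₀ : i.val ≠ 0 := fun h => by have := hfirst i h; omega
      have hi₁ : i.val + 1 ≠ n := fun h => by have := hlast i h; omega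
      obtain ⟨j, hj⟩ : ∃ j : Fin n, j.val + 1 = i.val := ⟨⟨i - 1, by omega⟩, by simp; omega⟩
      obtain ⟨k, hk⟩ : ∃ k : Fin n, i.val + 1 = k.val := ⟨⟨i + 1, by omega⟩, rfl⟩
      have := sum_Iio_of_add_one_eq b hj
      have := sum_Iio_of_add_one_eq b hk
      have := hadj j i hj
      have := hadj i k hk
      have := h₂ j (.inr hj)
      have := h₂ k (.inl hk)
      omega
    · omega

theorem psi_grid_characterization (n : ℕ) (hn : 1 ≤ n) :
    (∀ M : Finset (Fin 2 × Fin n), IsMaxIndep (gridGraph 2 n) M →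
      (∀ i : ℕ, ∀ h : i + 1 < n,
          ¬(psiG M ⟨i, by omega⟩ = 0 ∧ psiG M ⟨i + 1, h⟩ = 0)) ∧
      psiG M ⟨0, by omega⟩ = 1 ∧ psiG M ⟨n - 1, by omega⟩ = 1) ∧
    (∀ b : Fin n → ℕ, (∀ i, b i = 0 ∨ b i = 1) →
      (∀ i : ℕ, ∀ h : i + 1 < n, ¬(b ⟨i, by omega⟩ = 0 ∧ b ⟨i + 1, h⟩ = 0)) →
      b ⟨0, by omega⟩ = 1 → b ⟨n - 1, by omega⟩ = 1 →
      ∃ M M' : Finset (Fin 2 × Fin n),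
        M ≠ M' ∧
        IsMaxIndep (gridGraph 2 n) M ∧ IsMaxIndep (gridGraph 2 n) M' ∧
        (∀ i, psiG M i = b i) ∧ (∀ i, psiG M' i = b i) ∧
        M' = M.image rowSwap ∧
        (∀ N : Finset (Fin 2 × Fin n), IsMaxIndep (gridGraph 2 n) N →
          (∀ i, psiG N i = b i) → N = M ∨ N = M')) := by
  refine ⟨fun M hM => ⟨fun i h hz => ?_, ?_, ?_⟩, fun b hb hadj hfirst hlast => ?_⟩
  · obtain ⟨-, k, -, hk, r, -, hr⟩ := hM.exists_of_psiG_eq_zero hz.1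
    obtain rfl : k = ⟨i + 1, h⟩ := Fin.ext hk.symm
    exact psiG_eq_zero_iff.1 hz.2 _ hr
  · refine (hM.psiG_eq_zero_or_one _).resolve_left fun h => ?_
    obtain ⟨j, -, hj, -⟩ := hM.exists_of_psiG_eq_zero h
    simp at hj
  · refine (hM.psiG_eq_zero_or_one _).resolve_left fun h => ?_
    obtain ⟨-, k, -, hk, -⟩ := hM.exists_of_psiG_eq_zero h
    have : n - 1 + 1 = k.val := hk
    omega
  have hM : IsMaxIndep (gridGraph 2 n) (alternatingSet b) := by
    refine isMaxIndep_alternatingSet hb (fun i j hij => ?_) (fun i hi => ?_) fun i hi => ?_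
    · have h := hadj i (by omega)
      rw [show (⟨i.val + 1, by omega⟩ : Fin n) = j from Fin.ext hij, Fin.eta] at h
      have := hb i
      have := hb j
      omega
    · rwa [show i = ⟨0, by omega⟩ from Fin.ext hi]
    · rwa [show i = ⟨n - 1, by omega⟩ from Fin.ext (by simp; omega)]
  have hψ := psiG_alternatingSet hb
  generalize alternatingSet b = M at hM hψ
  have hslice := fun r => (hM.psiG_eq_one_iff r).1 ((hψ _).trans hfirst)
  refine ⟨M, M.image rowSwap, fun h => ?_, hM, hM.image_rowSwap, hψ,
    fun i => (psiG_image_rowSwap M i).trans (hψ i), rfl, fun N hN hNψ => ?_⟩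
  · have h₁ := hslice 0
    have h₂ := mem_image_rowSwap (M := M) (r := 0) (i := ⟨0, by omega⟩)
    rw [← h] at h₂
    tauto
  have hNslice := fun r => (hN.psiG_eq_one_iff r).1 ((hNψ _).trans hfirst)
  by_cases h : (0, (⟨0, by omega⟩ : Fin n)) ∈ N ↔ (0, ⟨0, by omega⟩) ∈ M
  · left
    refine hN.eq_of_psiG_eq hM (fun i => (hNψ i).trans (hψ i).symm) fun i hi => ?_
    rw [show i = ⟨0, by omega⟩ from Fin.ext hi]
    have h₁ := hslice 1
    have h₂ := hNslice 1
    rw [show Fin.rev (1 : Fin 2) = 0 from rfl] at h₁ h₂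
    exact Fin.forall_fin_two.2 ⟨h, by tauto⟩
  · right
    refine hN.eq_of_psiG_eq hM.image_rowSwap
      (fun i => (hNψ i).trans ((psiG_image_rowSwap M i).trans (hψ i)).symm) fun i hi => ?_
    rw [show i = ⟨0, by omega⟩ from Fin.ext hi]
    have h₁ := hslice 1
    have h₂ := hNslice 1
    rw [show Fin.rev (1 : Fin 2) = 0 from rfl] at h₁ h₂
    simp only [mem_image_rowSwap, Fin.forall_fin_two, show Fin.rev (1 : Fin 2) = 0 from rfl,
      show Fin.rev (0 : Fin 2) = 1 from rfl]
    tauto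
end
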